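/- arXiv:1211.5959 — 6 statements merged into one kernel-verified Lean document; each statement's English description precedes it below -/
import Mathlib

section
/- Let T be a Laver tree and let E be a Borel equivalence relation on [T] all of whose equivalence classes are countable. Then there is a Laver tree S with S ⊆ T such that the restriction of E to [S] is either the identity relation on [S] or the full relation [S] × [S]. -/
open Set Filter

/-- The restriction of `x : ℕ → ℕ` to `{0,…,n-1}`, as a finite sequence. -/
def seg (x : ℕ → ℕ) (n : ℕ) : List ℕ := List.ofFn fun i : Fin n => x i

/-- `s` is the stem of the tree `T`: it belongs to `T`, is comparable with every
element of `T`, and every node of `T` extending it splits infinitely. -/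
def IsStemOf (T : Set (List ℕ)) (s : List ℕ) : Prop :=
  s ∈ T ∧ (∀ t ∈ T, t <+: s ∨ s <+: t) ∧
    ∀ t ∈ T, s <+: t → {n : ℕ | t ++ [n] ∈ T}.Infinite

/-- A Laver tree: closed under initial segments, with a stem. -/
def IsLaverTree (T : Set (List ℕ)) : Prop :=
  (∀ s ∈ T, ∀ t : List ℕ, t <+: s → t ∈ T) ∧ ∃ s, IsStemOf T s

/-- `[T]`, the set of branches of `T`. -/
def branches (T : Set (List ℕ)) : Set (ℕ → ℕ) := {x | ∀ n, seg x n ∈ T}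

/-- `S ≤₀ T`: `S` is a Laver tree included in `T` with the same stem. -/
def DirectExt (S T : Set (List ℕ)) : Prop :=
  IsLaverTree S ∧ S ⊆ T ∧ ∃ s, IsStemOf S s ∧ IsStemOf T s

/-- An (proper, containing all finite sets) ideal on ℕ. -/
def IsIdeal (I : Set (Set ℕ)) : Prop :=
  (∀ A : Set ℕ, A.Finite → A ∈ I) ∧ (∀ A B : Set ℕ, A ⊆ B → B ∈ I → A ∈ I) ∧
    (∀ A B : Set ℕ, A ∈ I → B ∈ I → A ∪ B ∈ I) ∧ (Set.univ : Set ℕ) ∉ I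

/-- A P-ideal. -/
def IsPIdeal (I : Set (Set ℕ)) : Prop :=
  ∀ A : ℕ → Set ℕ, (∀ n, A n ∈ I) → ∃ B ∈ I, ∀ n, (A n \ B).Finite

/-- Characteristic function of a subset of ℕ, as a point of the Cantor space. -/
noncomputable def chi (A : Set ℕ) : ℕ → Bool :=
  fun n => @decide (n ∈ A) (Classical.propDecidable _)

/-- An F_σ set: a countable union of closed sets. -/
def IsFsigma {X : Type*} [TopologicalSpace X] (A : Set X) : Prop :=
  ∃ F : ℕ → Set X, (∀ n, IsClosed (F n)) ∧ A = ⋃ n, F n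

/-- An ideal on ℕ is F_σ if its copy in the Cantor space `ℕ → Bool` is F_σ. -/
def FsigmaIdeal (I : Set (Set ℕ)) : Prop := IsFsigma (chi '' I)

/-- The equivalence relation `E_I` on the Cantor space induced by an ideal `I`. -/
def EI (I : Set (Set ℕ)) (x y : ℕ → Bool) : Prop := {n | x n ≠ y n} ∈ I

/-- The generator `A_g` of the Laver ideal. -/
def laverGen (g : List ℕ → ℕ) : Set (ℕ → ℕ) := {f | {n | f n < g (seg f n)}.Infinite}

/-- Membership in the Laver ideal: covered by countably many generators. -/
def InLaverIdeal (A : Set (ℕ → ℕ)) : Prop :=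
  ∃ g : ℕ → List ℕ → ℕ, A ⊆ ⋃ i, laverGen (g i)

/-- The relation `K` on the Baire space. -/
def Krel (x y : ℕ → ℕ) : Prop :=
  ∃ b : ℕ, ∀ n : ℕ, ∃ mx ≤ b, ∃ my ≤ b, x n ≤ y (n + my) ∧ y n ≤ x (n + mx)

/-- `E_{ℓ∞}` on `ℝ^ℕ`: the difference sequence is bounded. -/
def Elinf (x y : ℕ → ℝ) : Prop := ∃ C : ℝ, ∀ n, |x n - y n| ≤ C

/-- A lower semicontinuous submeasure on ℕ. -/
def IsLSCSubmeasure (μ : Set ℕ → ENNReal) : Prop :=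
  μ ∅ = 0 ∧ (∀ A B : Set ℕ, A ⊆ B → μ A ≤ μ B) ∧
    (∀ A B : Set ℕ, μ (A ∪ B) ≤ μ A + μ B) ∧
    ∀ A : Set ℕ, μ A = ⨆ n : ℕ, μ (A ∩ Set.Iio n)

/-- `Exh(μ)`. -/
def Exh (μ : Set ℕ → ENNReal) : Set (Set ℕ) :=
  {A | Filter.Tendsto (fun n : ℕ => μ (A \ Set.Iio n)) Filter.atTop (nhds 0)}

/-- `Fin(μ)`. -/
def FinSub (μ : Set ℕ → ENNReal) : Set (Set ℕ) := {A | μ A < ⊤}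

theorem length_seg (x : ℕ → ℕ) (n : ℕ) : (seg x n).length = n := by simp [seg]

theorem seg_succ (x : ℕ → ℕ) (n : ℕ) : seg x (n + 1) = seg x n ++ [x n] := by
  rw [seg, List.ofFn_succ_last]
  rfl

theorem seg_prefix_seg (x : ℕ → ℕ) {m n : ℕ} (h : m ≤ n) : seg x m <+: seg x n := by
  induction n, h using Nat.le_induction with
  | base => exact List.prefix_rfl
  | succ n _ ih => exact ih.trans (by rw [seg_succ]; exact List.prefix_append _ _)

theorem eq_seg_of_prefix {x : ℕ → ℕ} {n : ℕ} {t : List ℕ} (h : t <+: seg x n) :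
    t = seg x t.length := by
  have hl : t.length ≤ n := by simpa [length_seg] using h.length_le
  exact (List.prefix_of_prefix_length_le h (seg_prefix_seg x hl)
    (by simp [length_seg])).eq_of_length (by simp [length_seg])

theorem seg_comparable (x : ℕ → ℕ) (m n : ℕ) : seg x m <+: seg x n ∨ seg x n <+: seg x m :=
  (le_total m n).imp (seg_prefix_seg x) (seg_prefix_seg x)

theorem seg_eq_seg_iff {x y : ℕ → ℕ} {n : ℕ} : seg x n = seg y n ↔ ∀ i < n, x i = y i := by
  simp only [seg, List.ofFn_inj, funext_iff]
  exact ⟨fun h i hi => h ⟨i, hi⟩, fun h i => h i i.2⟩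

theorem eq_of_append_prefix {x : ℕ → ℕ} {n k : ℕ} {t : List ℕ} (h : t ++ [k] <+: seg x n) :
    k = x t.length := by
  have h1 := eq_seg_of_prefix h
  rw [List.length_append, List.length_singleton, seg_succ] at h1
  simpa using (List.append_inj' h1 rfl).2

/-- Sets of sequences defined through finitely many coordinates are Borel. -/
theorem measurableSet_seg (n : ℕ) (P : List ℕ → Prop) :
    MeasurableSet {x : ℕ → ℕ | P (seg x n)} := by
  have h : Measurable fun (x : ℕ → ℕ) (i : Fin n) => x i :=
    measurable_pi_lambda _ fun i => measurable_pi_apply _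
  exact h (Set.to_countable {z : Fin n → ℕ | P (List.ofFn z)}).measurableSet

/-- `LaverAt s T`: the set `T` is a Laver tree with stem `s`. -/
structure LaverAt (s : List ℕ) (T : Set (List ℕ)) : Prop where
  closed : ∀ t ∈ T, ∀ r : List ℕ, r <+: t → r ∈ T
  stem : IsStemOf T s

/-- The nodes of `T` comparable with `t`. -/
def restr (T : Set (List ℕ)) (t : List ℕ) : Set (List ℕ) := {r ∈ T | r <+: t ∨ t <+: r}

theorem restr_subset (T : Set (List ℕ)) (t : List ℕ) : restr T t ⊆ T := fun _ h => h.1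

theorem restr_mono {S T : Set (List ℕ)} (h : S ⊆ T) (t : List ℕ) : restr S t ⊆ restr T t :=
  fun _ hr => ⟨h hr.1, hr.2⟩

theorem branches_mono {S T : Set (List ℕ)} (h : S ⊆ T) : branches S ⊆ branches T :=
  fun _ hx n => h (hx n)

theorem mem_branches_restr {T : Set (List ℕ)} {x : ℕ → ℕ} (hx : x ∈ branches T) (n : ℕ) :
    x ∈ branches (restr T (seg x n)) :=
  fun m => ⟨hx m, seg_comparable x m n⟩

namespace LaverAt

variable {s t : List ℕ} {S T : Set (List ℕ)}

theorem subset_restr (hS : LaverAt t S) (h : S ⊆ T) : S ⊆ restr T t :=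
  fun r hr => ⟨h hr, hS.stem.2.1 r hr⟩

theorem restr (hT : LaverAt s T) (hst : s <+: t) (ht : t ∈ T) : LaverAt t (restr T t) where
  closed := fun r hr q hq => ⟨hT.closed r hr.1 q hq, by
    rcases hr.2 with h | h
    · exact Or.inl (hq.trans h)
    · exact List.prefix_or_prefix_of_prefix hq h⟩
  stem := ⟨⟨ht, Or.inl List.prefix_rfl⟩, fun r hr => hr.2, fun r hr htr =>
    (hT.stem.2.2 r hr.1 (hst.trans htr)).mono fun _ hn =>
      ⟨hn, Or.inr (htr.trans (List.prefix_append _ _))⟩⟩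

theorem seg_eq_stem (hT : LaverAt s T) {x : ℕ → ℕ} (hx : x ∈ branches T) : seg x s.length = s := by
  rcases hT.stem.2.1 _ (hx s.length) with h | h
  · exact h.eq_of_length (length_seg _ _)
  · exact (h.eq_of_length (length_seg _ _).symm).symm

theorem mem_of_branch (hT : LaverAt s T) {x : ℕ → ℕ} (h : ∀ N, ∃ n ≥ N, seg x n ∈ T) :
    x ∈ branches T := fun N =>
  let ⟨_, hn, hx⟩ := h N
  hT.closed _ hx _ (seg_prefix_seg x hn)

end LaverAt

/-- The subtree of `T` obtained by keeping only the successors `s ++ [n]`, `n ∈ B`, of `s`. -/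
def keep (T : Set (List ℕ)) (s : List ℕ) (B : Set ℕ) : Set (List ℕ) :=
  {r ∈ T | r <+: s ∨ ∃ n ∈ B, s ++ [n] <+: r}

theorem keep_subset (T : Set (List ℕ)) (s : List ℕ) (B : Set ℕ) : keep T s B ⊆ T := fun _ h => h.1

theorem LaverAt.keep {s : List ℕ} {T : Set (List ℕ)} (hT : LaverAt s T) {B : Set ℕ}
    (hB : B.Infinite) (hBT : ∀ n ∈ B, s ++ [n] ∈ T) : LaverAt s (keep T s B) where
  closed := fun r hr q hq => ⟨hT.closed r hr.1 q hq, by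
    rcases hr.2 with h | ⟨n, hn, h⟩
    · exact Or.inl (hq.trans h)
    · rcases List.prefix_or_prefix_of_prefix hq h with h' | h'
      · rcases List.prefix_concat_iff.1 h' with rfl | h''
        · exact Or.inr ⟨n, hn, List.prefix_rfl⟩
        · exact Or.inl h''
      · exact Or.inr ⟨n, hn, h'⟩⟩
  stem := ⟨⟨hT.stem.1, Or.inl List.prefix_rfl⟩, fun r hr => hT.stem.2.1 r hr.1, fun r hr hsr => by
    by_cases hrs : r = s
    · subst hrs
      exact hB.mono fun n hn => ⟨hBT n hn, Or.inr ⟨n, hn, List.prefix_rfl⟩⟩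
    · refine (hT.stem.2.2 r hr.1 hsr).mono fun _ hn => ⟨hn, Or.inr ?_⟩
      rcases hr.2 with h | ⟨k, hk, h⟩
      · exact absurd (h.eq_of_length_le hsr.length_le) hrs
      · exact ⟨k, hk, h.trans (List.prefix_append _ _)⟩⟩

theorem mem_of_mem_branches_keep {s : List ℕ} {T : Set (List ℕ)} {B : Set ℕ} {x : ℕ → ℕ}
    (hx : x ∈ branches (keep T s B)) : x s.length ∈ B := by
  rcases (hx (s.length + 1)).2 with h | ⟨n, hn, h⟩
  · have := h.length_le
    simp [length_seg] at this
  · rwa [← eq_of_append_prefix h]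

/-- Laver trees with stems infinitely many successors of `t` glue to one with stem `t`. -/
theorem LaverAt.glue {t : List ℕ} {B : Set ℕ} (hB : B.Infinite) {S : ℕ → Set (List ℕ)}
    (hS : ∀ n ∈ B, LaverAt (t ++ [n]) (S n)) : LaverAt t (⋃ n ∈ B, S n) where
  closed := fun r hr q hq => by
    simp only [mem_iUnion] at hr ⊢
    obtain ⟨n, hn, h⟩ := hr
    exact ⟨n, hn, (hS n hn).closed r h q hq⟩
  stem := by
    have hpre : ∀ n, t <+: t ++ [n] := fun n => List.prefix_append _ _
    simp only [IsStemOf, mem_iUnion]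
    refine ⟨?_, ?_, ?_⟩
    · obtain ⟨n, hn⟩ := hB.nonempty
      exact ⟨n, hn, (hS n hn).closed _ (hS n hn).stem.1 _ (hpre n)⟩
    · rintro r ⟨n, hn, hr⟩
      rcases (hS n hn).stem.2.1 r hr with h | h
      · exact List.prefix_or_prefix_of_prefix h (hpre n)
      · exact Or.inr ((hpre n).trans h)
    · rintro r ⟨n, hn, hr⟩ htr
      rcases (hS n hn).stem.2.1 r hr with h | h
      · rcases List.prefix_concat_iff.1 h with rfl | h'
        · exact ((hS n hn).stem.2.2 _ hr List.prefix_rfl).mono fun k hk => ⟨n, hn, hk⟩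
        · obtain rfl : r = t := h'.eq_of_length_le htr.length_le
          exact hB.mono fun k hk => ⟨k, hk, (hS k hk).stem.1⟩
      · exact ((hS n hn).stem.2.2 r hr h).mono fun k hk => ⟨n, hn, hk⟩

theorem mem_branches_of_glue {t : List ℕ} {B : Set ℕ} {S : ℕ → Set (List ℕ)}
    (hS : ∀ n ∈ B, LaverAt (t ++ [n]) (S n)) {x : ℕ → ℕ} (hx : x ∈ branches (⋃ n ∈ B, S n)) :
    ∃ n ∈ B, x ∈ branches (S n) := by
  simp only [branches, mem_ofPred_eq, mem_iUnion] at hx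
  have key : ∀ m > t.length, ∃ _ : x t.length ∈ B, seg x m ∈ S (x t.length) := fun m hm => by
    obtain ⟨n, hn, h⟩ := hx m
    have hl : ¬ (seg x m <+: t) := fun h' => by
      have := h'.length_le
      rw [length_seg] at this
      omega
    have h2 : t ++ [n] <+: seg x m := by
      rcases (hS n hn).stem.2.1 _ h with h' | h'
      · rcases List.prefix_concat_iff.1 h' with h'' | h''
        · exact h'' ▸ List.prefix_rfl
        · exact absurd h'' hl
      · exact h'
    obtain rfl := eq_of_append_prefix h2
    exact ⟨hn, h⟩
  obtain ⟨hB, -⟩ := key (t.length + 1) (Nat.lt_succ_self _)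
  exact ⟨_, hB, (hS _ hB).mem_of_branch fun N =>
    ⟨N + t.length + 1, by omega, (key _ (by omega)).2⟩⟩

/-- The nodes reached when a shrinking operation `op` is applied at each node of `T` in turn,
together with the trees then attached to them. -/
inductive Reach (op : List ℕ → Set (List ℕ) → Set (List ℕ)) (s : List ℕ) (T : Set (List ℕ)) :
    List ℕ → Set (List ℕ) → Prop
  | base : Reach op s T s (op s T)
  | step {t : List ℕ} {R : Set (List ℕ)} (n : ℕ) : Reach op s T t R → t ++ [n] ∈ R →
      Reach op s T (t ++ [n]) (op (t ++ [n]) (restr R (t ++ [n])))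

theorem Reach.stem_prefix {op : List ℕ → Set (List ℕ) → Set (List ℕ)} {s : List ℕ}
    {T : Set (List ℕ)} {t : List ℕ} {R : Set (List ℕ)} (h : Reach op s T t R) : s <+: t := by
  induction h with
  | base => exact List.prefix_rfl
  | step n _ _ ih => exact ih.trans (List.prefix_append _ _)

theorem Reach.unique {op : List ℕ → Set (List ℕ) → Set (List ℕ)} {s : List ℕ}
    {T : Set (List ℕ)} {t : List ℕ} {R R' : Set (List ℕ)} (h : Reach op s T t R)
    (h' : Reach op s T t R') : R = R' := by
  have hne : ∀ {s t R n}, Reach op s T t R → s ≠ t ++ [n] := fun h e => by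
    have := h.stem_prefix.length_le
    rw [e] at this
    simp at this
  induction h generalizing R' with
  | base =>
    generalize hs : s = t at h'
    cases h' with
    | base => rfl
    | step n h _ => exact absurd rfl (hne h)
  | @step t R n h hn ih =>
    generalize ht : t ++ [n] = r at h'
    cases h' with
    | base => exact absurd ht.symm (hne h)
    | @step t' R'' n' hr hn' =>
      obtain ⟨rfl, e⟩ := List.append_inj' ht rfl
      obtain rfl : n = n' := by simpa using e
      rw [ih hr]

/-- Fusion: a property of trees which is dense and hereditary under shrinking without moving the
stem can be obtained simultaneously above all nodes. -/
theorem LaverAt.fusion {s : List ℕ} {T : Set (List ℕ)} (hT : LaverAt s T)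
    (Q : List ℕ → Set (List ℕ) → Prop)
    (dense : ∀ t R, LaverAt t R → R ⊆ T → s <+: t → ∃ R' ⊆ R, LaverAt t R' ∧ Q t R')
    (mono : ∀ t R R', Q t R → R' ⊆ R → Q t R') :
    ∃ S ⊆ T, LaverAt s S ∧ ∀ t ∈ S, s <+: t → Q t (_root_.restr S t) := by
  choose! op hop using dense
  have good : ∀ {t R}, Reach op s T t R → LaverAt t R ∧ R ⊆ T ∧ Q t R := fun h => by
    induction h with
    | base =>
      obtain ⟨h1, h2, h3⟩ := hop s T hT subset_rfl List.prefix_rfl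
      exact ⟨h2, h1, h3⟩
    | @step t R n h hn ih =>
      have hp : t <+: t ++ [n] := List.prefix_append _ _
      obtain ⟨h1, h2, h3⟩ := hop (t ++ [n]) (_root_.restr R (t ++ [n])) (ih.1.restr hp hn)
        ((restr_subset _ _).trans ih.2.1) (h.stem_prefix.trans hp)
      exact ⟨h2, h1.trans ((restr_subset _ _).trans ih.2.1), h3⟩
  have down : ∀ {r R}, Reach op s T r R → ∀ t, s <+: t → t <+: r →
      ∃ R', Reach op s T t R' ∧ R ⊆ R' := fun h => by
    induction h with
    | base =>
      intro t h1 h2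
      obtain rfl := h1.eq_of_length_le h2.length_le
      exact ⟨_, .base, subset_rfl⟩
    | @step r R n h hn ih =>
      intro t h1 h2
      rcases List.prefix_concat_iff.1 h2 with rfl | h2
      · exact ⟨_, .step n h hn, subset_rfl⟩
      · obtain ⟨R', hR', hsub⟩ := ih t h1 h2
        have hp : r <+: r ++ [n] := List.prefix_append _ _
        exact ⟨R', hR', ((hop _ _ ((good h).1.restr hp hn)
          ((restr_subset _ _).trans (good h).2.1) (h.stem_prefix.trans hp)).1.trans
          (restr_subset _ _)).trans hsub⟩
  refine ⟨{r | ∃ t R, Reach op s T t R ∧ r <+: t}, ?_, ⟨?_, ?_, ?_, ?_⟩, ?_⟩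
  · rintro r ⟨t, R, h, hr⟩
    exact (good h).2.1 ((good h).1.closed _ (good h).1.stem.1 _ hr)
  · rintro r ⟨t, R, h, hr⟩ q hq
    exact ⟨t, R, h, hq.trans hr⟩
  · exact ⟨s, _, .base, List.prefix_rfl⟩
  · rintro r ⟨t, R, h, hr⟩
    exact List.prefix_or_prefix_of_prefix hr h.stem_prefix
  · rintro r ⟨t, R, h, hr⟩ hsr
    obtain ⟨R', h', -⟩ := down h r hsr hr
    exact ((good h').1.stem.2.2 r (good h').1.stem.1 List.prefix_rfl).mono fun n hn =>
      ⟨_, _, .step n h' hn, List.prefix_rfl⟩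
  · rintro t ⟨t', R, h, hr⟩ hst
    obtain ⟨R', h', -⟩ := down h t hst hr
    refine mono t R' _ (good h').2.2 ?_
    rintro q ⟨⟨t₂, R₂, h₂, hq⟩, hqt | hqt⟩
    · exact (good h').1.closed _ (good h').1.stem.1 _ hqt
    · obtain ⟨R₃, h₃, hsub⟩ := down h₂ t hst (hqt.trans hq)
      obtain rfl := h'.unique h₃
      exact hsub ((good h₂).1.closed _ (good h₂).1.stem.1 _ hq)

/-- If a property of trees is inherited by larger trees and by gluing, then a tree without the
property has a subtree with the same stem which lacks it above each node. -/
theorem LaverAt.hereditarily_not {s : List ℕ} {T : Set (List ℕ)} (hT : LaverAt s T)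
    (G : List ℕ → Set (List ℕ) → Prop) (mono : ∀ t R R', G t R' → R' ⊆ R → G t R)
    (glue : ∀ t R, LaverAt t R →
      {n | t ++ [n] ∈ R ∧ G (t ++ [n]) (_root_.restr R (t ++ [n]))}.Infinite → G t R)
    (hG : ¬ G s T) :
    ∃ S ⊆ T, LaverAt s S ∧ ∀ t ∈ S, s <+: t → ¬ G t (_root_.restr S t) := by
  let S : Set (List ℕ) :=
    {t ∈ T | ∀ r, r <+: t → s <+: r → ¬ G r (_root_.restr T r)}
  have hST : S ⊆ T := fun t h => h.1
  have hrs : _root_.restr T s ⊆ T := restr_subset _ _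
  refine ⟨S, hST, ⟨?_, ?_, ?_, ?_⟩, fun t ht hst h => ht.2 t List.prefix_rfl hst
    (mono _ _ _ h (restr_mono hST t))⟩
  · exact fun t ht r hr => ⟨hT.closed t ht.1 r hr, fun q hq => ht.2 q (hq.trans hr)⟩
  · refine ⟨hT.stem.1, fun r h1 h2 h => ?_⟩
    obtain rfl := h2.eq_of_length_le h1.length_le
    exact hG (mono _ _ _ h hrs)
  · exact fun t ht => hT.stem.2.1 t ht.1
  · intro t ht hst
    have hfin : {n | t ++ [n] ∈ _root_.restr T t ∧
        G (t ++ [n]) (_root_.restr (_root_.restr T t) (t ++ [n]))}.Finite := by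
      by_contra hinf
      exact ht.2 t List.prefix_rfl hst (glue t _ (hT.restr hst ht.1) hinf)
    refine ((hT.stem.2.2 t ht.1 hst).sdiff hfin).mono fun n hn => ⟨hn.1, fun r h1 h2 => ?_⟩
    have hp : t <+: t ++ [n] := List.prefix_append _ _
    rcases List.prefix_concat_iff.1 h1 with rfl | h1
    · refine fun h => hn.2 ⟨⟨hn.1, Or.inr hp⟩, mono _ _ _ h fun q hq => ⟨⟨hq.1, ?_⟩, hq.2⟩⟩
      rcases hq.2 with h' | h'
      · exact List.prefix_or_prefix_of_prefix h' hp
      · exact Or.inr (hp.trans h')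
    · exact ht.2 r h1 h2

/-- Every Laver tree has a subtree with the same stem whose branches all lie in `A`, or all lie
outside `A`. -/
def PurelyDecided (A : Set (ℕ → ℕ)) : Prop :=
  ∀ s T, LaverAt s T → ∃ S ⊆ T, LaverAt s S ∧ (branches S ⊆ A ∨ branches S ⊆ Aᶜ)

theorem purelyDecided_eval (i k : ℕ) : PurelyDecided {x | x i = k} := by
  intro s T hT
  by_cases hi : i < s.length
  · refine ⟨T, subset_rfl, hT, ?_⟩
    by_cases h : ∃ x ∈ branches T, x i = k
    · obtain ⟨x, hx, hxk⟩ := h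
      refine Or.inl fun y hy => ?_
      have := seg_eq_seg_iff.1 ((hT.seg_eq_stem hx).trans (hT.seg_eq_stem hy).symm) i hi
      exact this.symm.trans hxk
    · exact Or.inr fun y hy hyk => h ⟨y, hy, hyk⟩
  · refine ⟨{t ∈ T | t[i]? ≠ some k}, fun t h => h.1, ⟨?_, ⟨hT.stem.1, ?_⟩,
      fun t ht => hT.stem.2.1 t ht.1, ?_⟩, Or.inr fun x hx hxk => ?_⟩
    · refine fun t ht r hr => ⟨hT.closed t ht.1 r hr, fun h => ht.2 ?_⟩
      obtain ⟨q, rfl⟩ := hr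
      rw [List.getElem?_append_left (List.getElem?_eq_some_iff.1 h).1, h]
    · rw [List.getElem?_eq_none (not_lt.1 hi)]
      simp
    · intro t ht hst
      refine ((hT.stem.2.2 t ht.1 hst).sdiff (Set.finite_singleton k)).mono fun n hn =>
        ⟨hn.1, fun h => ?_⟩
      rw [List.getElem?_append] at h
      split_ifs at h with hl
      · exact ht.2 h
      · rw [List.getElem?_singleton] at h
        split_ifs at h
        exact hn.2 (Option.some.inj h)
    · refine (hx (i + 1)).2 ?_
      have : x i = k := hxk
      rw [seg, List.getElem?_ofFn]
      simp [this]

theorem PurelyDecided.compl {A : Set (ℕ → ℕ)} (hA : PurelyDecided A) : PurelyDecided Aᶜ :=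
  fun s T hT => by
    obtain ⟨S, hST, hS, h⟩ := hA s T hT
    exact ⟨S, hST, hS, by rwa [compl_compl, or_comm]⟩

theorem PurelyDecided.iUnion {A : ℕ → Set (ℕ → ℕ)} (hA : ∀ n, PurelyDecided (A n)) :
    PurelyDecided (⋃ n, A n) := fun s T hT => by
  by_cases hG : ∃ S ⊆ T, LaverAt s S ∧ branches S ⊆ ⋃ n, A n
  · obtain ⟨S, hST, hS, h⟩ := hG
    exact ⟨S, hST, hS, Or.inl h⟩
  obtain ⟨T₀, hT₀T, hT₀, hbad⟩ := hT.hereditarily_not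
    (fun t R => ∃ S ⊆ R, LaverAt t S ∧ branches S ⊆ ⋃ n, A n)
    (fun t R R' ⟨S, h1, h2⟩ h => ⟨S, h1.trans h, h2⟩) (fun t R hR hinf => by
      have hn : ∀ n ∈ {n | t ++ [n] ∈ R ∧ ∃ S ⊆ restr R (t ++ [n]), LaverAt (t ++ [n]) S ∧
        branches S ⊆ ⋃ n, A n}, ∃ S ⊆ restr R (t ++ [n]), LaverAt (t ++ [n]) S ∧
        branches S ⊆ ⋃ n, A n := fun n h => h.2
      choose! S hS using hn
      refine ⟨_, iUnion₂_subset fun n hn => (hS n hn).1.trans (restr_subset _ _),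
        LaverAt.glue hinf fun n hn => (hS n hn).2.1, fun x hx => ?_⟩
      obtain ⟨n, hn, hx⟩ := mem_branches_of_glue (fun n hn => (hS n hn).2.1) hx
      exact (hS n hn).2.2 hx) hG
  obtain ⟨S, hST, hS, hQ⟩ := hT₀.fusion
    (fun t R => branches R ⊆ (A (t.length - s.length))ᶜ) (fun t R hR hRT hst => by
      obtain ⟨S, hSR, hS, h | h⟩ := hA (t.length - s.length) t R hR
      · exact absurd ⟨S, hS.subset_restr (hSR.trans hRT), hS, h.trans (subset_iUnion A _)⟩
          (hbad t (hRT hR.stem.1) hst)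
      · exact ⟨S, hSR, hS, h⟩) (fun t R R' h h' => (branches_mono h').trans h)
  refine ⟨S, hST.trans hT₀T, hS, Or.inr fun x hx h => ?_⟩
  obtain ⟨n, hn⟩ := mem_iUnion.1 h
  have hp : s <+: seg x (s.length + n) := by
    have := seg_prefix_seg x (Nat.le_add_right s.length n)
    rwa [hS.seg_eq_stem hx] at this
  have := hQ _ (hx _) hp (mem_branches_restr hx _)
  rw [length_seg, Nat.add_sub_cancel_left] at this
  exact this hn

/-- Pure decision for Borel sets. -/
theorem MeasurableSet.purelyDecided {A : Set (ℕ → ℕ)} (hA : MeasurableSet A) :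
    PurelyDecided A := by
  let m : MeasurableSpace (ℕ → ℕ) :=
    { MeasurableSet' := PurelyDecided
      measurableSet_empty := fun s T hT => ⟨T, subset_rfl, hT, Or.inr (by simp)⟩
      measurableSet_compl := fun A hA => hA.compl
      measurableSet_iUnion := fun A hA => PurelyDecided.iUnion hA }
  have hm : MeasurableSpace.pi ≤ m := iSup_le fun i => by
    rintro _ ⟨B, -, rfl⟩
    have : (fun x : ℕ → ℕ => x i) ⁻¹' B = ⋃ k ∈ B, {x | x i = k} := by
      ext x
      simp
    rw [this]
    exact @MeasurableSet.biUnion _ _ m _ _ (Set.to_countable B)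
      fun k _ => purelyDecided_eval i k
  exact hm A hA

/-- The partial function coded by the family `g`: its value at `x` is `y` if the sets `g i m`
containing `x` are exactly those with `y i = m`. -/
def CodesValue (g : ℕ → ℕ → Set (ℕ → ℕ)) (x y : ℕ → ℕ) : Prop := ∀ i m, x ∈ g i m ↔ y i = m

/-- `g` codes no value `y ∈ [T]` at any `x ∈ [S]`. -/
def Avoids (g : ℕ → ℕ → Set (ℕ → ℕ)) (S T : Set (List ℕ)) : Prop :=
  ∀ x ∈ branches S, ∀ y ∈ branches T, ¬ CodesValue g x y

theorem Avoids.mono {g : ℕ → ℕ → Set (ℕ → ℕ)} {S S' T T' : Set (List ℕ)} (h : Avoids g S T)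
    (hS : S' ⊆ S) (hT : T' ⊆ T) : Avoids g S' T' :=
  fun x hx y hy => h x (branches_mono hS hx) y (branches_mono hT hy)

theorem LaverAt.exists_avoids {s t : List ℕ} {S T : Set (List ℕ)} (hS : LaverAt s S)
    (hT : LaverAt t T) {g : ℕ → ℕ → Set (ℕ → ℕ)} (hg : ∀ i m, MeasurableSet (g i m)) :
    ∃ S' ⊆ S, ∃ T' ⊆ T, LaverAt s S' ∧ LaverAt t T' ∧ Avoids g S' T' := by
  let e := (hT.stem.2.2 t hT.stem.1 List.prefix_rfl).natEmbedding
  have key : ∀ f : ℕ → ℕ, f.Injective → (range fun n => (e (f n) : ℕ)).Infinite ∧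
      ∀ n ∈ range fun n => (e (f n) : ℕ), t ++ [n] ∈ T := fun f hf =>
    ⟨infinite_range_of_injective (Subtype.val_injective.comp (e.injective.comp hf)), by
      rintro _ ⟨n, rfl⟩
      exact (e (f n)).2⟩
  obtain ⟨hi₁, hT₁⟩ := key (fun n => 2 * n) fun a b h => by
    simpa using h
  obtain ⟨hi₂, hT₂⟩ := key (fun n => 2 * n + 1) fun a b h => by
    simpa using h
  set B₁ := range fun n => (e (2 * n) : ℕ)
  set B₂ := range fun n => (e (2 * n + 1) : ℕ)
  have hdisj : ∀ n ∈ B₁, n ∉ B₂ := by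
    rintro _ ⟨a, rfl⟩ ⟨b, h⟩
    have := e.injective (Subtype.ext h)
    omega
  have hmeas : MeasurableSet (⋃ m ∈ B₁, g t.length m) :=
    MeasurableSet.biUnion (Set.to_countable _) fun m _ => hg _ m
  obtain ⟨S', hS'S, hS', h | h⟩ := hmeas.purelyDecided s S hS
  · refine ⟨S', hS'S, _, keep_subset _ _ _, hS', hT.keep hi₂ hT₂, fun x hx y hy hxy => ?_⟩
    obtain ⟨m, hm, hxm⟩ := mem_iUnion₂.1 (h hx)
    refine hdisj m hm ?_
    rw [← (hxy _ _).1 hxm]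
    exact mem_of_mem_branches_keep hy
  · refine ⟨S', hS'S, _, keep_subset _ _ _, hS', hT.keep hi₁ hT₁, fun x hx y hy hxy => ?_⟩
    exact h hx (mem_iUnion₂.2 ⟨_, mem_of_mem_branches_keep hy, (hxy _ _).2 rfl⟩)

/-- A finite approximation to a subtree of `T` with stem `s`: the finite set `nodes` of nodes
already put into the subtree, and for each of them a Laver tree `res t` from which its future
extensions are to be taken. -/
structure Approx (s : List ℕ) (T : Set (List ℕ)) where
  nodes : Finset (List ℕ)
  res : List ℕ → Set (List ℕ)
  stem_mem : s ∈ nodes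
  stem_prefix : ∀ t ∈ nodes, s <+: t
  mem_of_prefix : ∀ t ∈ nodes, ∀ r, s <+: r → r <+: t → r ∈ nodes
  laverAt : ∀ t ∈ nodes, LaverAt t (res t)
  res_subset : ∀ t ∈ nodes, res t ⊆ T
  prefix_of_mem : ∀ t ∈ nodes, ∀ r ∈ nodes, r ∈ res t → r <+: t

namespace Approx

variable {s : List ℕ} {T : Set (List ℕ)}

instance : Preorder (Approx s T) where
  le p q := p.nodes ⊆ q.nodes ∧ (∀ t ∈ p.nodes, q.res t ⊆ p.res t) ∧
    ∀ r ∈ q.nodes, ∃ t ∈ p.nodes, q.res r ⊆ p.res t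
  le_refl p := ⟨subset_rfl, fun _ _ => subset_rfl, fun r hr => ⟨r, hr, subset_rfl⟩⟩
  le_trans p q r h h' := ⟨h.1.trans h'.1, fun t ht => (h'.2.1 t (h.1 ht)).trans (h.2.1 t ht),
    fun u hu => by
      obtain ⟨v, hv, huv⟩ := h'.2.2 u hu
      obtain ⟨w, hw, hvw⟩ := h.2.2 v hv
      exact ⟨w, hw, huv.trans hvw⟩⟩

theorem exists_child (p : Approx s T) {t : List ℕ} (ht : t ∈ p.nodes) (m : ℕ) :
    ∃ q ≥ p, ∃ k ≥ m, t ++ [k] ∈ q.nodes := by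
  classical
  have hR := p.laverAt t ht
  have hinf := hR.stem.2.2 t hR.stem.1 List.prefix_rfl
  obtain ⟨k, hk, hmk⟩ := hinf.exists_gt m
  have hkt : ¬ t ++ [k] <+: t := fun h => by
    simpa using h.length_le
  have hpre : t <+: t ++ [k] := List.prefix_append _ _
  have hne : t ≠ t ++ [k] := by simp
  have hknot : t ++ [k] ∉ p.nodes := fun h => hkt (p.prefix_of_mem t ht _ h hk)
  let B : Set ℕ := {n | t ++ [n] ∈ p.res t} \ {k}
  let R : List ℕ → Set (List ℕ) := fun r => if r = t ++ [k] then restr (p.res t) (t ++ [k]) else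
    if r = t then keep (p.res t) t B else p.res r
  have hRk : R (t ++ [k]) = restr (p.res t) (t ++ [k]) := if_pos rfl
  have hRt : R t = keep (p.res t) t B := by simp [R]
  have hRo : ∀ r, r ≠ t ++ [k] → r ≠ t → R r = p.res r := fun r h h' => by simp [R, h, h']
  have hsub : ∀ r ∈ p.nodes, R r ⊆ p.res r := fun r hr => by
    by_cases h : r = t
    · subst h
      rw [hRt]
      exact keep_subset _ _ _
    · rw [hRo r (fun e => hknot (e ▸ hr)) h]
  refine ⟨⟨insert (t ++ [k]) p.nodes, R, Finset.mem_insert_of_mem p.stem_mem, ?_, ?_, ?_, ?_, ?_⟩,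
    ⟨Finset.subset_insert _ _, hsub, ?_⟩, k, hmk.le, Finset.mem_insert_self _ _⟩
  · intro r hr
    rcases Finset.mem_insert.1 hr with rfl | hr
    · exact (p.stem_prefix t ht).trans hpre
    · exact p.stem_prefix r hr
  · intro r hr q hsq hqr
    rcases Finset.mem_insert.1 hr with rfl | hr
    · rcases List.prefix_concat_iff.1 hqr with rfl | hqt
      · exact Finset.mem_insert_self _ _
      · exact Finset.mem_insert_of_mem (p.mem_of_prefix t ht q hsq hqt)
    · exact Finset.mem_insert_of_mem (p.mem_of_prefix r hr q hsq hqr)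
  · intro r hr
    rcases Finset.mem_insert.1 hr with rfl | hr
    · rw [hRk]
      exact hR.restr hpre hk
    · by_cases h : r = t
      · subst h
        rw [hRt]
        exact hR.keep (hinf.sdiff (Set.finite_singleton k)) fun n hn => hn.1
      · rw [hRo r (fun e => hknot (e ▸ hr)) h]
        exact p.laverAt r hr
  · intro r hr
    rcases Finset.mem_insert.1 hr with rfl | hr
    · rw [hRk]
      exact (restr_subset _ _).trans (p.res_subset t ht)
    · exact (hsub r hr).trans (p.res_subset r hr)
  · intro a ha b hb hba
    rcases Finset.mem_insert.1 ha with rfl | ha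
    · rw [hRk] at hba
      rcases Finset.mem_insert.1 hb with rfl | hb
      · exact List.prefix_rfl
      · exact (p.prefix_of_mem t ht b hb hba.1).trans hpre
    · rcases Finset.mem_insert.1 hb with rfl | hb
      · by_cases h : a = t
        · subst h
          rw [hRt] at hba
          rcases hba.2 with h | ⟨n, hn, h⟩
          · exact h
          · have : n = k := by simpa using h.eq_of_length (by simp)
            exact absurd this hn.2
        · have hba' := hsub a ha hba
          rcases (p.laverAt a ha).stem.2.1 _ hba' with h' | h'
          · exact h'
          · rcases List.prefix_concat_iff.1 h' with h' | h'
            · exact absurd (h' ▸ ha) hknot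
            · have := p.prefix_of_mem a ha t ht ((p.laverAt a ha).closed _ hba' _ hpre)
              exact absurd (h'.eq_of_length_le this.length_le) h
      · exact p.prefix_of_mem a ha b hb (hsub a ha hba)
  · intro r hr
    rcases Finset.mem_insert.1 hr with rfl | hr
    · refine ⟨t, ht, ?_⟩
      change R _ ⊆ _
      rw [hRk]
      exact restr_subset _ _
    · exact ⟨r, hr, hsub r hr⟩

theorem exists_avoids (p : Approx s T) {g : ℕ → ℕ → Set (ℕ → ℕ)}
    (hg : ∀ i m, MeasurableSet (g i m)) :
    ∃ q ≥ p, q.nodes = p.nodes ∧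
      ∀ a ∈ q.nodes, ∀ b ∈ q.nodes, a ≠ b → Avoids g (q.res a) (q.res b) := by
  classical
  have key : ∀ P : Finset (List ℕ × List ℕ), ∃ R : List ℕ → Set (List ℕ),
      (∀ t ∈ p.nodes, LaverAt t (R t) ∧ R t ⊆ p.res t) ∧ ∀ a ∈ p.nodes, ∀ b ∈ p.nodes,
        a ≠ b → (a, b) ∈ P → Avoids g (R a) (R b) := fun P => by
    induction P using Finset.induction with
    | empty => exact ⟨p.res, fun t ht => ⟨p.laverAt t ht, subset_rfl⟩, by simp⟩
    | @insert c P _ ih =>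
      obtain ⟨R, hR, hP⟩ := ih
      obtain ⟨a, b⟩ := c
      by_cases hab : a ∈ p.nodes ∧ b ∈ p.nodes ∧ a ≠ b
      · obtain ⟨ha, hb, hab⟩ := hab
        obtain ⟨A, hA, B, hB, hLA, hLB, hAB⟩ := (hR a ha).1.exists_avoids (hR b hb).1 hg
        let R' : List ℕ → Set (List ℕ) := fun t => if t = a then A else if t = b then B else R t
        have hRa : R' a = A := if_pos rfl
        have hRb : R' b = B := by simp [R', hab.symm]
        have hRo : ∀ t, t ≠ a → t ≠ b → R' t = R t := fun t h h' => by simp [R', h, h']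
        have hsub : ∀ t, R' t ⊆ R t := fun t => by
          by_cases h : t = a
          · subst h
            rwa [hRa]
          · by_cases h' : t = b
            · subst h'
              rwa [hRb]
            · rw [hRo t h h']
        refine ⟨R', fun t ht => ⟨?_, (hsub t).trans (hR t ht).2⟩, fun u hu v hv huv h => ?_⟩
        · by_cases h : t = a
          · subst h
            rwa [hRa]
          · by_cases h' : t = b
            · subst h'
              rwa [hRb]
            · rw [hRo t h h']
              exact (hR t ht).1
        · rcases Finset.mem_insert.1 h with h | h
          · obtain ⟨rfl, rfl⟩ := Prod.mk.inj h
            rwa [hRa, hRb]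
          · exact (hP u hu v hv huv h).mono (hsub u) (hsub v)
      · refine ⟨R, hR, fun u hu v hv huv h => ?_⟩
        rcases Finset.mem_insert.1 h with h | h
        · obtain ⟨rfl, rfl⟩ := Prod.mk.inj h
          exact absurd ⟨hu, hv, huv⟩ hab
        · exact hP u hu v hv huv h
  obtain ⟨R, hR, hP⟩ := key (p.nodes ×ˢ p.nodes)
  exact ⟨⟨p.nodes, R, p.stem_mem, p.stem_prefix, p.mem_of_prefix, fun t ht => (hR t ht).1,
    fun t ht => (hR t ht).2.trans (p.res_subset t ht),
    fun t ht r hr h => p.prefix_of_mem t ht r hr ((hR t ht).2 h)⟩,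
    ⟨subset_rfl, fun t ht => (hR t ht).2, fun r hr => ⟨r, hr, (hR r hr).2⟩⟩, rfl,
    fun a ha b hb hab => hP a ha b hb hab (Finset.mk_mem_product ha hb)⟩

end Approx

/-- Countably many Borel partial functions have a common free Laver subtree. -/
theorem LaverAt.exists_free {s : List ℕ} {T : Set (List ℕ)} (hT : LaverAt s T)
    {g : ℕ → ℕ → ℕ → Set (ℕ → ℕ)} (hg : ∀ n i m, MeasurableSet (g n i m)) :
    ∃ S ⊆ T, LaverAt s S ∧
      ∀ x ∈ branches S, ∀ y ∈ branches S, ∀ n, CodesValue (g n) x y → x = y := by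
  classical
  let p₀ : Approx s T := ⟨{s}, fun _ => T, by simp, by simp, fun t ht r h h' => by
    rw [Finset.mem_singleton] at ht ⊢
    subst ht
    exact h'.eq_of_length_le h.length_le, by simpa using hT, by simp, by simp⟩
  let D : List ℕ × ℕ → Order.Cofinal (Approx s T) := fun c =>
    ⟨{p | (c.1 ∈ p.nodes ∧ (∃ k ≥ c.2, c.1 ++ [k] ∈ p.nodes) ∧
        ∀ a ∈ p.nodes, ∀ b ∈ p.nodes, a ≠ b → Avoids (g c.2) (p.res a) (p.res b)) ∨
        ∀ q ≥ p, c.1 ∉ q.nodes}, fun p => by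
      by_cases h : ∃ q ≥ p, c.1 ∈ q.nodes
      · obtain ⟨q, hpq, hq⟩ := h
        obtain ⟨q₁, hq₁, k, hk, hkq⟩ := q.exists_child hq c.2
        obtain ⟨q₂, hq₂, he, hav⟩ := q₁.exists_avoids (hg c.2)
        refine ⟨q₂, Or.inl ⟨?_, ⟨k, hk, ?_⟩, hav⟩, hpq.trans (hq₁.trans hq₂)⟩
        · exact he ▸ hq₁.1 hq
        · rwa [he]
      · exact ⟨p, Or.inr fun q hq hc => h ⟨q, hq, hc⟩, le_rfl⟩⟩
  let I := Order.idealOfCofinals p₀ D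
  have hdir : ∀ p ∈ I, ∀ q ∈ I, ∃ r ∈ I, p ≤ r ∧ q ≤ r := I.directed
  have hmeet : ∀ p ∈ I, ∀ r ∈ p.nodes, ∀ n, ∃ q ∈ I, r ∈ q.nodes ∧
      (∃ k ≥ n, r ++ [k] ∈ q.nodes) ∧
        ∀ a ∈ q.nodes, ∀ b ∈ q.nodes, a ≠ b → Avoids (g n) (q.res a) (q.res b) := by
    intro p hp r hr n
    obtain ⟨q, hqD, hq⟩ := Order.cofinal_meets_idealOfCofinals p₀ D (r, n)
    rcases hqD with h | h
    · exact ⟨q, hq, h⟩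
    · obtain ⟨q', -, h1, h2⟩ := hdir p hp q hq
      exact absurd (h1.1 hr) (h q' h2)
  let S : Set (List ℕ) := {r | ∃ p ∈ I, ∃ t ∈ p.nodes, r <+: t}
  have hnode : ∀ r ∈ S, s <+: r → ∃ p ∈ I, r ∈ p.nodes := by
    rintro r ⟨p, hp, t, ht, hrt⟩ hsr
    exact ⟨p, hp, p.mem_of_prefix t ht r hsr hrt⟩
  have hS : LaverAt s S := by
    refine ⟨?_, ⟨p₀, Order.mem_idealOfCofinals p₀ D, s, p₀.stem_mem, List.prefix_rfl⟩, ?_, ?_⟩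
    · rintro r ⟨p, hp, t, ht, hrt⟩ q hq
      exact ⟨p, hp, t, ht, hq.trans hrt⟩
    · rintro r ⟨p, hp, t, ht, hrt⟩
      exact List.prefix_or_prefix_of_prefix hrt (p.stem_prefix t ht)
    · intro r hr hsr
      obtain ⟨p, hp, hrp⟩ := hnode r hr hsr
      refine infinite_of_forall_exists_gt fun n => ?_
      obtain ⟨q, hq, -, ⟨k, hk, hkq⟩, -⟩ := hmeet p hp r hrp (n + 1)
      exact ⟨k, ⟨q, hq, _, hkq, List.prefix_rfl⟩, hk⟩
  have hres : ∀ x ∈ branches S, ∀ p ∈ I, ∃ t ∈ p.nodes, x ∈ branches (p.res t) := by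
    intro x hx p hp
    have h1 : ∀ n, ∃ t ∈ p.nodes, seg x n ∈ p.res t := by
      intro n
      obtain ⟨q, hq, r, hr, hnr⟩ := hx n
      obtain ⟨q', -, hpq, hqq⟩ := hdir p hp q hq
      obtain ⟨t, ht, hsub⟩ := hpq.2.2 r (hqq.1 hr)
      have hL := q'.laverAt r (hqq.1 hr)
      exact ⟨t, ht, hsub (hL.closed _ hL.stem.1 _ hnr)⟩
    by_contra! h
    have h2 : ∀ t ∈ p.nodes, ∃ n, seg x n ∉ p.res t := fun t ht => by
      simpa [branches] using h t ht
    choose! N hN using h2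
    obtain ⟨t, ht, hmem⟩ := h1 (p.nodes.sup N)
    exact hN t ht ((p.laverAt t ht).closed _ hmem _ (seg_prefix_seg x (Finset.le_sup ht)))
  refine ⟨S, ?_, hS, fun x hx y hy n hxy => ?_⟩
  · rintro r ⟨p, hp, t, ht, hrt⟩
    have hL := p.laverAt t ht
    exact p.res_subset t ht (hL.closed _ hL.stem.1 _ hrt)
  · have hagree : ∀ j ≥ s.length, seg x j = seg y j := by
      intro j hj
      have hp : s <+: seg x j := by
        have := seg_prefix_seg x hj
        rwa [hS.seg_eq_stem hx] at this
      obtain ⟨p, hpI, hxp⟩ := hnode _ (hx j) hp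
      obtain ⟨q, hq, hxq, -, hav⟩ := hmeet p hpI _ hxp n
      obtain ⟨a, ha, hxa⟩ := hres x hx q hq
      obtain ⟨b, hb, hyb⟩ := hres y hy q hq
      obtain rfl : a = b := by
        by_contra hab
        exact hav a ha b hb hab x hxa y hyb hxy
      have hja := q.prefix_of_mem a ha _ hxq (hxa j)
      have hya : a = seg y a.length := ((q.laverAt a ha).seg_eq_stem hyb).symm
      have := eq_seg_of_prefix (hya ▸ hja)
      rwa [length_seg] at this
    funext i
    exact seg_eq_seg_iff.1 (hagree (s.length + i + 1) (by omega)) i (by omega)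

section Uniformization

variable (a b : (ℕ → ℕ) → ℕ → ℕ)

/-- Countably many Borel partial functions catch `b w` at `a w` whenever `w` extends `u` and
`a w` is a branch of `R`. -/
def Covered (R : Set (List ℕ)) (u : List ℕ) : Prop :=
  ∃ 𝓕 : Set (ℕ → ℕ → Set (ℕ → ℕ)), 𝓕.Countable ∧ (∀ g ∈ 𝓕, ∀ i m, MeasurableSet (g i m)) ∧
    ∀ w, seg w u.length = u → a w ∈ branches R → ∃ g ∈ 𝓕, CodesValue g (a w) (b w)

/-- Some subtree of `R` with stem `t` is covered. -/
def SmallAt (t : List ℕ) (R : Set (List ℕ)) (u : List ℕ) : Prop :=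
  ∃ S ⊆ R, LaverAt t S ∧ Covered a b S u

/-- Some coordinate of `b` takes distinct constant values on the extensions of `u` and `v`. -/
def Separated (u v : List ℕ) : Prop :=
  ∃ i m n, m ≠ n ∧ (∀ w, seg w u.length = u → b w i = m) ∧ ∀ w, seg w v.length = v → b w i = n

variable {a b}

theorem Covered.mono {R R' : Set (List ℕ)} {u : List ℕ} (h : Covered a b R u) (hR : R' ⊆ R) :
    Covered a b R' u :=
  let ⟨F, hF, hm, h⟩ := h
  ⟨F, hF, hm, fun w hw hx => h w hw (branches_mono hR hx)⟩

theorem SmallAt.mono {t : List ℕ} {R R' : Set (List ℕ)} {u : List ℕ} (h : SmallAt a b t R' u)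
    (hR : R' ⊆ R) : SmallAt a b t R u :=
  let ⟨S, hS, h⟩ := h
  ⟨S, hS.trans hR, h⟩

theorem exists_of_not_small {t : List ℕ} {R : Set (List ℕ)} {u : List ℕ} (hR : LaverAt t R)
    (h : ¬ SmallAt a b t R u) : ∃ w, seg w u.length = u ∧ a w ∈ branches R := by
  by_contra! hw
  exact h ⟨R, subset_rfl, hR, ∅, countable_empty, by simp, fun w h1 h2 => absurd h2 (hw w h1)⟩

theorem SmallAt.glue {t : List ℕ} {R : Set (List ℕ)} {u : List ℕ}
    (hinf : {n | t ++ [n] ∈ R ∧ SmallAt a b (t ++ [n]) (restr R (t ++ [n])) u}.Infinite) :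
    SmallAt a b t R u := by
  have hn : ∀ n ∈ {n | t ++ [n] ∈ R ∧ SmallAt a b (t ++ [n]) (restr R (t ++ [n])) u},
      SmallAt a b (t ++ [n]) (restr R (t ++ [n])) u := fun n h => h.2
  choose! S hSR hS F hF hm hw using hn
  refine ⟨_, iUnion₂_subset fun n hn => (hSR n hn).trans (restr_subset _ _),
    LaverAt.glue hinf hS, _, (Set.to_countable _).biUnion hF, ?_, ?_⟩
  · intro g hg
    obtain ⟨n, hn, hg⟩ := mem_iUnion₂.1 hg
    exact hm n hn g hg
  · intro w hwu hx
    obtain ⟨n, hn, hx⟩ := mem_branches_of_glue hS hx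
    obtain ⟨g, hg, h⟩ := hw n hn w hwu hx
    exact ⟨g, mem_iUnion₂.2 ⟨n, hn, hg⟩, h⟩

theorem exists_hereditarily_not_small {s : List ℕ} {T : Set (List ℕ)} (hT : LaverAt s T)
    (U : Finset (List ℕ)) (hU : ∀ u ∈ U, ¬ SmallAt a b s T u) :
    ∃ S ⊆ T, LaverAt s S ∧ ∀ t ∈ S, s <+: t → ∀ u ∈ U, ¬ SmallAt a b t (restr S t) u := by
  classical
  induction U using Finset.induction with
  | empty => exact ⟨T, subset_rfl, hT, by simp⟩
  | @insert v U _ ih =>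
    obtain ⟨S, hST, hS, h⟩ := ih fun u hu => hU u (Finset.mem_insert_of_mem hu)
    obtain ⟨S', hS'S, hS', h'⟩ := hS.hereditarily_not (fun t R => SmallAt a b t R v)
      (fun _ _ _ h h' => h.mono h') (fun _ _ _ h => SmallAt.glue h)
      (fun h => hU v (Finset.mem_insert_self _ _) (h.mono hST))
    refine ⟨S', hS'S.trans hST, hS', fun t ht hst u hu => ?_⟩
    rcases Finset.mem_insert.1 hu with rfl | hu
    · exact h' t ht hst
    · exact fun hsm => h t (hS'S ht) hst u hu (hsm.mono (restr_mono hS'S t))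

theorem exists_covered_or_not_small {t : List ℕ} {R : Set (List ℕ)} (hR : LaverAt t R)
    (V : Finset (List ℕ)) :
    ∃ R' ⊆ R, LaverAt t R' ∧ ∀ v ∈ V, Covered a b R' v ∨ ¬ SmallAt a b t R' v := by
  classical
  induction V using Finset.induction with
  | empty => exact ⟨R, subset_rfl, hR, by simp⟩
  | @insert v V _ ih =>
    obtain ⟨R₁, hR₁R, hR₁, h⟩ := ih
    have mono : ∀ R₂ ⊆ R₁, ∀ u ∈ V, Covered a b R₂ u ∨ ¬ SmallAt a b t R₂ u := fun R₂ hR₂ u hu =>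
      (h u hu).imp (fun h => h.mono hR₂) (fun h h' => h (h'.mono hR₂))
    by_cases hv : SmallAt a b t R₁ v
    · obtain ⟨R₂, hR₂, hL, hc⟩ := hv
      refine ⟨R₂, hR₂.trans hR₁R, hL, fun u hu => ?_⟩
      rcases Finset.mem_insert.1 hu with rfl | hu
      · exact Or.inl hc
      · exact mono R₂ hR₂ u hu
    · refine ⟨R₁, hR₁R, hR₁, fun u hu => ?_⟩
      rcases Finset.mem_insert.1 hu with rfl | hu
      · exact Or.inr hv
      · exact h u hu

theorem exists_seg_const (hb : Continuous b) (w : ℕ → ℕ) (i N : ℕ) :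
    ∃ k ≥ N, ∀ w', seg w' k = seg w k → b w' i = b w i := by
  have hc : IsOpen {w' | b w' i = b w i} :=
    (isOpen_discrete {b w i}).preimage ((continuous_apply i).comp hb)
  obtain ⟨_, ⟨x, n, rfl⟩, hw, hsub⟩ := (PiNat.isTopologicalBasis_cylinders
    (fun _ => ℕ)).exists_subset_of_mem_open (show w ∈ {w' | b w' i = b w i} from rfl) hc
  refine ⟨max n N, le_max_right _ _, fun w' h => hsub ?_⟩
  rw [PiNat.mem_cylinder_iff] at hw ⊢
  exact fun j hj => (seg_eq_seg_iff.1 h j (lt_max_of_lt_left hj)).trans (hw j hj)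

theorem exists_separated_of_not_small (hb : Continuous b) {s : List ℕ} {T : Set (List ℕ)}
    (hT : LaverAt s T) {u : List ℕ} (hu : ¬ SmallAt a b s T u) :
    ∃ t, s <+: t ∧ t ∈ T ∧ ∃ S ⊆ T, LaverAt t S ∧ ∃ u₁ u₂, (u <+: u₁ ∧ u.length < u₁.length) ∧
      (u <+: u₂ ∧ u.length < u₂.length) ∧ Separated b u₁ u₂ ∧
      ¬ SmallAt a b t S u₁ ∧ ¬ SmallAt a b t S u₂ := by
  classical
  by_contra hno
  push Not at hno
  have hfin : ∀ n : ℕ, {v : List ℕ | Encodable.encode v ≤ n}.Finite := fun n =>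
    (Set.finite_Iic n).preimage Encodable.encode_injective.injOn
  obtain ⟨S, hST, hS, hQ⟩ := hT.fusion
    (fun t R => ∀ v, Encodable.encode v ≤ t.length → Covered a b R v ∨ ¬ SmallAt a b t R v)
    (fun t R hR _ _ => by
      obtain ⟨R', h1, h2, h3⟩ := exists_covered_or_not_small (a := a) (b := b) hR
        (hfin t.length).toFinset
      exact ⟨R', h1, h2, fun v hv => h3 v (by simpa using hv)⟩)
    (fun t R R' h hR v hv =>
      (h v hv).imp (fun h => h.mono hR) (fun h h' => h (h'.mono hR)))
  have hpre : ∀ x ∈ branches S, ∀ n ≥ s.length, s <+: seg x n := fun x hx n hn => by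
    have := seg_prefix_seg x hn
    rwa [hS.seg_eq_stem hx] at this
  refine hu ⟨S, hST, hS, ?_⟩
  let g : ℕ → ℕ → Set (ℕ → ℕ) := fun i m =>
    ⋃ v ∈ {v : List ℕ | (u <+: v ∧ u.length < v.length) ∧ ∀ w, seg w v.length = v → b w i = m},
      ⋂ n ∈ {n | s.length ≤ n ∧ Encodable.encode v ≤ n},
        {x | ¬ SmallAt a b (seg x n) (restr S (seg x n)) v}
  have hg : ∀ i m, MeasurableSet (g i m) := fun i m =>
    MeasurableSet.biUnion (Set.to_countable _) fun v _ =>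
      MeasurableSet.biInter (Set.to_countable _) fun n _ =>
        measurableSet_seg n fun t => ¬ SmallAt a b t (restr S t) v
  choose! F hF hFm hFw using fun (c : List ℕ × List ℕ) (h : Covered a b (restr S c.1) c.2) => h
  let C : Set (List ℕ × List ℕ) := {c | Covered a b (restr S c.1) c.2}
  refine ⟨insert g (⋃ c ∈ C, F c), ((Set.to_countable C).biUnion hF).insert g, ?_, ?_⟩
  · rintro f (rfl | hf)
    · exact hg
    · obtain ⟨c, hc, hf⟩ := mem_iUnion₂.1 hf
      exact hFm c hc f hf
  · intro w hw hx
    by_cases hcov : ∃ n k, Covered a b (restr S (seg (a w) n)) (seg w k)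
    · obtain ⟨n, k, hc⟩ := hcov
      obtain ⟨f, hf, h⟩ := hFw (seg (a w) n, seg w k) hc w
        (show seg w (seg w k).length = _ by rw [length_seg]) (mem_branches_restr hx n)
      exact ⟨f, Or.inr (mem_iUnion₂.2 ⟨_, hc, hf⟩), h⟩
    push Not at hcov
    have hval : ∀ i, a w ∈ g i (b w i) := fun i => by
      obtain ⟨k, hk, hconst⟩ := exists_seg_const hb w i (u.length + 1)
      refine mem_iUnion₂.2 ⟨seg w k, ⟨⟨?_, by rw [length_seg]; omega⟩, ?_⟩,
        mem_iInter₂.2 fun n hn => ?_⟩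
      · rw [← hw]
        exact seg_prefix_seg w (by omega)
      · rwa [length_seg]
      · exact (hQ _ (hx n) (hpre _ hx n hn.1) (seg w k)
          (by simpa [length_seg] using hn.2)).resolve_left (hcov n k)
    refine ⟨g, Or.inl rfl, fun i m => ⟨fun hm => ?_, fun h => h ▸ hval i⟩⟩
    by_contra hne
    obtain ⟨v₁, ⟨hv₁, hc₁⟩, h₁⟩ := mem_iUnion₂.1 (hval i)
    obtain ⟨v₂, ⟨hv₂, hc₂⟩, h₂⟩ := mem_iUnion₂.1 hm
    let n := s.length + Encodable.encode v₁ + Encodable.encode v₂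
    have hsn : s <+: seg (a w) n := hpre _ hx n (by omega)
    refine mem_iInter₂.1 h₂ n ⟨by omega, by omega⟩
      (hno (seg (a w) n) hsn (hST (hx n)) (restr S (seg (a w) n)) ((restr_subset _ _).trans hST)
        (hS.restr hsn (hx n)) v₁ v₂ hv₁ hv₂ ⟨i, _, _, hne, hc₁, hc₂⟩
        (mem_iInter₂.1 h₁ n ⟨by omega, by omega⟩))

theorem exists_longer_not_small {t : List ℕ} {R : Set (List ℕ)} (hR : LaverAt t R)
    {U : Finset (List ℕ)} (hU : ∀ u ∈ U, ¬ SmallAt a b t R u) :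
    ∃ t' S, t <+: t' ∧ t.length < t'.length ∧ S ⊆ R ∧ LaverAt t' S ∧
      ∀ u ∈ U, ¬ SmallAt a b t' S u := by
  obtain ⟨S, hSR, hS, h⟩ := exists_hereditarily_not_small hR U hU
  obtain ⟨n, hn⟩ := (hS.stem.2.2 t hS.stem.1 List.prefix_rfl).nonempty
  have hp : t <+: t ++ [n] := List.prefix_append _ _
  exact ⟨t ++ [n], restr S (t ++ [n]), hp, by simp, (restr_subset _ _).trans hSR, hS.restr hp hn,
    h _ hn hp⟩

/-- Finitely many uncovered `u` can be split simultaneously, keeping those in `V` uncovered. -/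
theorem exists_split (hb : Continuous b) (U : Finset (List ℕ)) :
    ∀ (t : List ℕ) (R : Set (List ℕ)) (V : Finset (List ℕ)), LaverAt t R →
      (∀ u ∈ U, ¬ SmallAt a b t R u) → (∀ v ∈ V, ¬ SmallAt a b t R v) →
      ∃ t' S, ∃ c : Bool → List ℕ → List ℕ, t <+: t' ∧ S ⊆ R ∧ LaverAt t' S ∧
        (∀ v ∈ V, ¬ SmallAt a b t' S v) ∧ ∀ u ∈ U, Separated b (c false u) (c true u) ∧
          ∀ e, u <+: c e u ∧ u.length < (c e u).length ∧ ¬ SmallAt a b t' S (c e u) := by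
  classical
  induction U using Finset.induction with
  | empty => exact fun t R V hR _ hV => ⟨t, R, fun _ => id, List.prefix_rfl, subset_rfl, hR, hV,
      by simp⟩
  | @insert u U hu ih =>
    intro t R V hR hU hV
    obtain ⟨S₀, hS₀R, hS₀, h₀⟩ := exists_hereditarily_not_small hR (insert u U ∪ V) fun v hv =>
      (Finset.mem_union.1 hv).elim (hU v) (hV v)
    obtain ⟨t₁, ht₁, ht₁S, S₁, hS₁, hL₁, u₁, u₂, hu₁, hu₂, hsep, hn₁, hn₂⟩ :=
      exists_separated_of_not_small hb hS₀
        fun h => hU u (Finset.mem_insert_self _ _) (h.mono hS₀R)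
    have h₁ : ∀ v ∈ insert u U ∪ V, ¬ SmallAt a b t₁ S₁ v := fun v hv h =>
      h₀ t₁ ht₁S ht₁ v hv (h.mono (hL₁.subset_restr hS₁))
    obtain ⟨t', S, c, ht', hS, hL, hV', hc⟩ := ih t₁ S₁ (insert u₁ (insert u₂ V)) hL₁
      (fun v hv => h₁ v (by simp [hv])) (by
        intro v hv
        simp only [Finset.mem_insert] at hv
        rcases hv with rfl | rfl | hv
        · exact hn₁
        · exact hn₂
        · exact h₁ v (by simp [hv]))
    refine ⟨t', S, fun e v => if v = u then cond e u₂ u₁ else c e v, ht₁.trans ht',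
      hS.trans (hS₁.trans hS₀R), hL, fun v hv => hV' v (by simp [hv]), fun v hv => ?_⟩
    by_cases hvu : v = u
    · subst hvu
      refine ⟨by simpa using hsep, fun e => ?_⟩
      cases e
      · simpa using ⟨hu₁.1, hu₁.2, hV' u₁ (by simp)⟩
      · simpa using ⟨hu₂.1, hu₂.2, hV' u₂ (by simp)⟩
    · simpa [hvu] using hc v ((Finset.mem_insert.1 hv).resolve_left hvu)

theorem exists_seg_eq_of_chain {u : ℕ → List ℕ} (h : ∀ n, u n <+: u (n + 1))
    (hl : ∀ n, (u n).length < (u (n + 1)).length) : ∃ w, ∀ n, seg w (u n).length = u n := by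
  have hmono : ∀ m n, m ≤ n → u m <+: u n := fun m n hmn => by
    induction n, hmn using Nat.le_induction with
    | base => exact List.prefix_rfl
    | succ n _ ih => exact ih.trans (h n)
  have hlen : ∀ n, n ≤ (u n).length := fun n => by
    induction n with
    | zero => exact Nat.zero_le _
    | succ n ih => exact Nat.succ_le_of_lt (ih.trans_lt (hl n))
  refine ⟨fun i => (u (i + 1))[i]'(hlen (i + 1)), fun n => ?_⟩
  refine List.ext_getElem (length_seg _ _) fun i h₁ h₂ => ?_
  simp only [seg, List.getElem_ofFn]
  rcases le_total (i + 1) n with hin | hin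
  · exact (hmono _ _ hin).getElem _
  · exact ((hmono _ _ hin).getElem _).symm

/-- A tree on which `b w` ranges over countable sets as a function of `a w` has a covered subtree
with the same stem. -/
theorem LaverAt.smallAt_nil (ha : Continuous a) (hb : Continuous b) {s : List ℕ}
    {T : Set (List ℕ)} (hT : LaverAt s T)
    (hc : ∀ x, {y | ∃ w, a w = x ∧ b w = y}.Countable) : SmallAt a b s T [] := by
  classical
  by_contra hsm
  let St := {p : List ℕ × Set (List ℕ) × Finset (List ℕ) //
    LaverAt p.1 p.2.1 ∧ ∀ u ∈ p.2.2, ¬ SmallAt a b p.1 p.2.1 u}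
  have step : ∀ p : St, ∃ q : St, ∃ c : Bool → List ℕ → List ℕ,
      p.1.1.length < q.1.1.length ∧ ∀ u ∈ p.1.2.2, Separated b (c false u) (c true u) ∧
        ∀ e, u <+: c e u ∧ u.length < (c e u).length ∧ c e u ∈ q.1.2.2 := by
    rintro ⟨⟨t, R, U⟩, hR, hU⟩
    obtain ⟨t₁, R₁, -, hlt, -, hL₁, hU₁⟩ := exists_longer_not_small hR hU
    obtain ⟨t₂, R₂, c, ht, -, hL₂, -, hU₂⟩ := exists_split hb U t₁ R₁ ∅ hL₁ hU₁ (by simp)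
    refine ⟨⟨(t₂, R₂, U.image (c false) ∪ U.image (c true)), hL₂, fun v hv => ?_⟩, c,
      hlt.trans_le ht.length_le, fun u hu => ⟨(hU₂ u hu).1, fun e =>
        ⟨((hU₂ u hu).2 e).1, ((hU₂ u hu).2 e).2.1, ?_⟩⟩⟩
    · simp only [Finset.mem_union, Finset.mem_image] at hv
      rcases hv with ⟨u, hu, rfl⟩ | ⟨u, hu, rfl⟩
      · exact ((hU₂ u hu).2 _).2.2
      · exact ((hU₂ u hu).2 _).2.2
    · cases e
      · exact Finset.mem_union_left _ (Finset.mem_image_of_mem _ hu)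
      · exact Finset.mem_union_right _ (Finset.mem_image_of_mem _ hu)
  choose next c hnext hsplit using step
  let p : ℕ → St := fun n =>
    Nat.rec ⟨(s, T, {[]}), hT, by simpa using hsm⟩ (fun _ q => next q) n
  let u : (ℕ → Bool) → ℕ → List ℕ := fun β n => Nat.rec [] (fun n v => c (p n) (β n) v) n
  have hu : ∀ β n, u β n ∈ (p n).1.2.2 := fun β n => by
    induction n with
    | zero => exact Finset.mem_singleton_self _
    | succ n ih => exact ((hsplit (p n) _ ih).2 (β n)).2.2
  have hpl : ∀ n, n ≤ (p n).1.1.length := fun n => by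
    induction n with
    | zero => exact Nat.zero_le _
    | succ n ih => exact Nat.succ_le_of_lt (ih.trans_lt (hnext (p n)))
  have hul : ∀ β n, n ≤ (u β n).length := fun β n => by
    induction n with
    | zero => exact Nat.zero_le _
    | succ n ih =>
      exact Nat.succ_le_of_lt (ih.trans_lt ((hsplit (p n) _ (hu β n)).2 (β n)).2.1)
  have hw : ∀ β, ∃ w, ∀ n, seg w (u β n).length = u β n := fun β => exists_seg_eq_of_chain
    (fun n => ((hsplit (p n) _ (hu β n)).2 (β n)).1)
    (fun n => ((hsplit (p n) _ (hu β n)).2 (β n)).2.1)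
  choose w hw using hw
  have approx : ∀ β i, ∃ k, ∀ n ≥ k, ∃ x, seg x (p n).1.1.length = (p n).1.1 ∧
      a (w β) i = x i := fun β i => by
    obtain ⟨k, -, hk⟩ := exists_seg_const ha (w β) i 0
    refine ⟨k, fun n hn => ?_⟩
    obtain ⟨w', hw', hx⟩ := exists_of_not_small (p n).2.1 ((p n).2.2 _ (hu β n))
    refine ⟨a w', (p n).2.1.seg_eq_stem hx, (hk w' (seg_eq_seg_iff.2 fun j hj => ?_)).symm⟩
    exact seg_eq_seg_iff.1 (hw'.trans (hw β n).symm) j (hj.trans_le (hn.trans (hul β n)))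
  have haw : ∀ β β', a (w β) = a (w β') := fun β β' => funext fun i => by
    obtain ⟨k, hk⟩ := approx β i
    obtain ⟨k', hk'⟩ := approx β' i
    obtain ⟨x, hx, h⟩ := hk (k + k' + (i + 1)) (by omega)
    obtain ⟨x', hx', h'⟩ := hk' (k + k' + (i + 1)) (by omega)
    rw [h, h', seg_eq_seg_iff.1 (hx.trans hx'.symm) i
      (lt_of_lt_of_le (by omega) (hpl (k + k' + (i + 1))))]
  have hne : ∀ β β' n, u β n = u β' n → β n = false → β' n = true → b (w β) ≠ b (w β') := by
    intro β β' n hn h h' he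
    obtain ⟨i, m, m', hmm, h₁, h₂⟩ := (hsplit (p n) _ (hu β n)).1
    have e₁ : u β (n + 1) = c (p n) false (u β n) := by rw [← h]
    have e₂ : u β' (n + 1) = c (p n) true (u β n) := by rw [← h', hn]
    exact hmm (((h₁ _ (e₁ ▸ hw β (n + 1))).symm.trans (congrFun he i)).trans
      (h₂ _ (e₂ ▸ hw β' (n + 1))))
  have hinj : Function.Injective fun β => b (w β) := fun β β' he => by
    have hall : ∀ n, u β n = u β' n := fun n => by
      induction n with
      | zero => rfl
      | succ n ih =>
        have : β n = β' n := by
          cases h : β n <;> cases h' : β' n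
          · rfl
          · exact absurd he (hne _ _ n ih h h')
          · exact absurd he.symm (hne _ _ n ih.symm h' h)
          · rfl
        change c (p n) (β n) (u β n) = c (p n) (β' n) (u β' n)
        rw [this, ih]
    funext n
    cases h : β n <;> cases h' : β' n
    · rfl
    · exact absurd he (hne _ _ n (hall n) h h')
    · exact absurd he.symm (hne _ _ n (hall n).symm h' h)
    · rfl
  have hcount : (range fun β => b (w β)).Countable := (hc (a (w fun _ => false))).mono <| by
    rintro _ ⟨β, rfl⟩
    exact ⟨w β, haw _ _, rfl⟩
  have : Countable (ℕ → Bool) := by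
    have := hcount.to_subtype
    exact (rangeFactorization_injective.2 hinj).countable
  obtain ⟨f, hf⟩ := exists_surjective_nat (ℕ → Bool)
  obtain ⟨n, hn⟩ := hf fun n => !(f n n)
  simpa using congrFun hn n

end Uniformization

/-- canonization for Borel equivalence relations with countable
classes on Laver trees. -/
theorem stmt4 (T : Set (List ℕ)) (hT : IsLaverTree T)
    (E : Set ((ℕ → ℕ) × (ℕ → ℕ))) (hEborel : MeasurableSet E)
    (hEsub : E ⊆ (branches T) ×ˢ (branches T))
    (hrefl : ∀ x ∈ branches T, (x, x) ∈ E)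
    (hsymm : ∀ x y, (x, y) ∈ E → (y, x) ∈ E)
    (htrans : ∀ x y z, (x, y) ∈ E → (y, z) ∈ E → (x, z) ∈ E)
    (hcount : ∀ x ∈ branches T, {y | (x, y) ∈ E}.Countable) :
    ∃ S, IsLaverTree S ∧ S ⊆ T ∧
      ((∀ x ∈ branches S, ∀ y ∈ branches S, ((x, y) ∈ E ↔ x = y)) ∨
        (∀ x ∈ branches S, ∀ y ∈ branches S, (x, y) ∈ E)) := by
  obtain ⟨hcl, s, hs⟩ := hT
  have hL : LaverAt s T := ⟨hcl, hs⟩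
  have hcov : ∃ S ⊆ T, LaverAt s S ∧ ∃ g : ℕ → ℕ → ℕ → Set (ℕ → ℕ),
      (∀ n i m, MeasurableSet (g n i m)) ∧
        ∀ x ∈ branches S, ∀ y, (x, y) ∈ E → ∃ n, CodesValue (g n) x y := by
    have han := hEborel.analyticSet
    rw [MeasureTheory.AnalyticSet] at han
    rcases han with rfl | ⟨f, hf, rfl⟩
    · exact ⟨T, subset_rfl, hL, fun _ _ _ => ∅, by simp, by simp⟩
    obtain ⟨S, hST, hS, F, hF, hFm, hFw⟩ := hL.smallAt_nil (continuous_fst.comp hf)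
      (continuous_snd.comp hf) fun x => by
        by_cases hx : x ∈ branches T
        · refine (hcount x hx).mono ?_
          rintro y ⟨w, rfl, rfl⟩
          exact ⟨w, rfl⟩
        · convert countable_empty
          refine eq_empty_of_forall_notMem ?_
          rintro y ⟨w, rfl, rfl⟩
          exact hx (hEsub ⟨w, rfl⟩).1
    obtain ⟨g, hg⟩ := (hF.insert fun _ _ => ∅).exists_eq_range (insert_nonempty _ _)
    refine ⟨S, hST, hS, g, fun n => ?_, ?_⟩
    · rcases (hg ▸ mem_range_self n : g n ∈ insert _ F) with h | h
      · simp [h]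
      · exact hFm _ h
    · rintro x hx y ⟨w, hw⟩
      obtain ⟨h, hhF, hh⟩ := hFw w rfl (by simpa [hw] using hx)
      obtain ⟨n, rfl⟩ : h ∈ range g := hg ▸ mem_insert_of_mem _ hhF
      exact ⟨n, by simpa [hw] using hh⟩
  obtain ⟨S₀, hS₀T, hS₀, g, hg, hcode⟩ := hcov
  obtain ⟨S, hSS₀, hS, hfree⟩ := hS₀.exists_free hg
  refine ⟨S, ⟨hS.closed, s, hS.stem⟩, hSS₀.trans hS₀T, Or.inl fun x hx y hy => ⟨fun h => ?_, ?_⟩⟩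
  · obtain ⟨n, hn⟩ := hcode x (branches_mono hSS₀ hx) y h
    exact hfree x hx y hy n hn
  · rintro rfl
    exact hrefl x (branches_mono (hSS₀.trans hS₀T) hx)
end

section
/- For any two Laver trees T and S there are branches x₁, x₂ ∈ [T] and y₁, y₂ ∈ [S] such that x₁ K y₁ and ¬(x₂ K y₂). -/
open Set Filter

theorem exists_seq_eq_of_history {α : Type*} (H : List α → α) :
    ∃ z : ℕ → α, ∀ n, z n = H (List.ofFn fun i : Fin n => z i) := by
  let L : ℕ → List α := fun n => Nat.rec [] (fun _ l => l ++ [H l]) n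
  refine ⟨fun n => H (L n), fun n => congrArg H ?_⟩
  induction n with
  | zero => simp [L]
  | succ n ih =>
    rw [List.ofFn_succ_last]
    simp only [Fin.val_castSucc, Fin.val_last]
    rw [← ih]

theorem le_sum_seg (x : ℕ → ℕ) {i n : ℕ} (h : i < n) : x i ≤ (seg x n).sum :=
  List.le_sum_of_mem (List.mem_ofFn.2 ⟨⟨i, h⟩, rfl⟩)

/-- Above the stem, a node of a Laver tree has arbitrarily large immediate successors;
below it, it has at least one. -/
theorem IsStemOf.exists_succ {T : Set (List ℕ)} {s : List ℕ}
    (hT : ∀ s ∈ T, ∀ t : List ℕ, t <+: s → t ∈ T) (hs : IsStemOf T s)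
    {t : List ℕ} (ht : t ∈ T) (m : ℕ) :
    ∃ k, t ++ [k] ∈ T ∧ (s.length ≤ t.length → m ≤ k) := by
  obtain ⟨hsT, hcomp, hinf⟩ := hs
  by_cases hst : s <+: t
  · obtain ⟨k, hk, hmk⟩ := (hinf t ht hst).exists_gt m
    exact ⟨k, hk, fun _ => hmk.le⟩
  · obtain ⟨r, rfl⟩ := (hcomp t ht).resolve_right hst
    cases r with
    | nil => simp at hst
    | cons k r =>
      exact ⟨k, hT _ hsT _ ⟨r, by simp⟩, fun h => by simp at h⟩

/-- A strategy `e` for building branches of a Laver tree which, from the level `N` of the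
stem on, exceed any prescribed bounds. -/
theorem IsLaverTree.exists_strategy {T : Set (List ℕ)} (hT : IsLaverTree T) :
    ∃ (N : ℕ) (e : List ℕ → ℕ → ℕ), ∀ x f : ℕ → ℕ, (∀ n, x n = e (seg x n) (f n)) →
      x ∈ branches T ∧ ∀ n, N ≤ n → f n ≤ x n := by
  obtain ⟨hcl, s, hs⟩ := hT
  have h : ∀ t m, ∃ k, t ∈ T → t ++ [k] ∈ T ∧ (s.length ≤ t.length → m ≤ k) := by
    intro t m
    by_cases ht : t ∈ T
    · obtain ⟨k, hk⟩ := hs.exists_succ hcl ht m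
      exact ⟨k, fun _ => hk⟩
    · exact ⟨0, fun h => absurd h ht⟩
  choose e he using h
  refine ⟨s.length, e, fun x f hx => ?_⟩
  have hmem : ∀ n, seg x n ∈ T := by
    intro n
    induction n with
    | zero => exact hcl s hs.1 _ (by simp [seg])
    | succ n ih =>
      rw [seg_succ, hx n]
      exact (he _ _ ih).1
  refine ⟨hmem, fun n hn => ?_⟩
  rw [hx n]
  exact (he _ _ (hmem n)).2 (by rwa [length_seg])

theorem IsLaverTree.exists_branch_ge {T : Set (List ℕ)} (hT : IsLaverTree T) (f : ℕ → ℕ) :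
    ∃ x ∈ branches T, ∃ N, ∀ n, N ≤ n → f n ≤ x n := by
  obtain ⟨N, e, he⟩ := hT.exists_strategy
  obtain ⟨x, hx⟩ := exists_seq_eq_of_history fun l => e l (f l.length)
  obtain ⟨hxT, hle⟩ := he x f fun n => by
    rw [hx n]
    simp [seg]
  exact ⟨x, hxT, N, hle⟩

/-- Two Laver trees have branches that eventually exceed all earlier values of each other. -/
theorem IsLaverTree.exists_interleaved_branches {T S : Set (List ℕ)} (hT : IsLaverTree T)
    (hS : IsLaverTree S) :
    ∃ x ∈ branches T, ∃ y ∈ branches S, ∃ N, ∀ n, N ≤ n → ∀ i < n, x i ≤ y n ∧ y i ≤ x n := by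
  obtain ⟨N, e, he⟩ := hT.exists_strategy
  obtain ⟨M, d, hd⟩ := hS.exists_strategy
  obtain ⟨z, hz⟩ := exists_seq_eq_of_history fun l : List (ℕ × ℕ) =>
    (e (l.map Prod.fst) (l.map Prod.snd).sum, d (l.map Prod.snd) (l.map Prod.fst).sum)
  set x : ℕ → ℕ := fun n => (z n).1 with hx
  set y : ℕ → ℕ := fun n => (z n).2 with hy
  have hfst : ∀ n, (List.ofFn fun i : Fin n => z i).map Prod.fst = seg x n := fun n => by
    rw [List.map_ofFn]
    rfl
  have hsnd : ∀ n, (List.ofFn fun i : Fin n => z i).map Prod.snd = seg y n := fun n => by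
    rw [List.map_ofFn]
    rfl
  simp only [hfst, hsnd] at hz
  obtain ⟨hxT, hxle⟩ := he x (fun n => (seg y n).sum) fun n => congrArg Prod.fst (hz n)
  obtain ⟨hyS, hyle⟩ := hd y (fun n => (seg x n).sum) fun n => congrArg Prod.snd (hz n)
  exact ⟨x, hxT, y, hyS, max N M, fun n hn i hi =>
    ⟨(le_sum_seg x hi).trans (hyle n (le_of_max_le_right hn)),
      (le_sum_seg y hi).trans (hxle n (le_of_max_le_left hn))⟩⟩

/-- any two Laver trees contain a `K`-related pair of branches and
a `K`-unrelated pair of branches. -/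
theorem stmt5 (T S : Set (List ℕ)) (hT : IsLaverTree T) (hS : IsLaverTree S) :
    (∃ x₁ ∈ branches T, ∃ y₁ ∈ branches S, Krel x₁ y₁) ∧
      (∃ x₂ ∈ branches T, ∃ y₂ ∈ branches S, ¬ Krel x₂ y₂) := by
  constructor
  · obtain ⟨x, hx, y, hy, N, h⟩ := hT.exists_interleaved_branches hS
    refine ⟨x, hx, y, hy, N + 1, fun n => ⟨N + 1, le_rfl, N + 1, le_rfl, ?_⟩⟩
    exact h (n + (N + 1)) (by omega) n (by omega)
  · obtain ⟨x, hx, -⟩ := hT.exists_branch_ge 0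
    obtain ⟨y, hy, N, h⟩ := hS.exists_branch_ge fun n => (seg x (2 * n + 1)).sum + 1
    refine ⟨x, hx, y, hy, ?_⟩
    rintro ⟨b, hb⟩
    obtain ⟨m, hm, -, -, -, hle⟩ := hb (max N b)
    have h₁ := h (max N b) (le_max_left _ _)
    have h₂ : x (max N b + m) ≤ _ :=
      le_sum_seg x (n := 2 * max N b + 1) (by omega)
    omega
end

section
/- E_{ℓ∞} is Borel reducible to K: there exists a Borel function g : ℝ^ℕ → ℕ^ℕ such that for all x, y ∈ ℝ^ℕ, x E_{ℓ∞} y if and only if g(x) K g(y). -/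
open Set Filter

/-- The truncation of `x k` to `[-l, l]`, shifted by `l` and rounded down, where `p` codes
the pair `(k, l)`. -/
noncomputable def truncCode (x : ℕ → ℝ) (p : ℕ) : ℕ :=
  min ⌊x p.unpair.1 + p.unpair.2⌋₊ (2 * p.unpair.2)

/-- A monotone sequence carrying the information of `truncCode x`. -/
noncomputable def monoCode (x : ℕ → ℝ) (p : ℕ) : ℕ := 2 * p ^ 2 + truncCode x p

/-- The counting function of `f`, for `f` satisfying `p ≤ f p`. -/
def countBelow (f : ℕ → ℕ) (n : ℕ) : ℕ := ((Finset.range (n + 1)).filter fun p => f p ≤ n).card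

lemma truncCode_le (x : ℕ → ℝ) (p : ℕ) : truncCode x p ≤ 2 * p :=
  (min_le_right _ _).trans (Nat.mul_le_mul_left 2 (Nat.unpair_right_le p))

lemma monoCode_monotone (x : ℕ → ℝ) : Monotone (monoCode x) := by
  refine monotone_nat_of_le_succ fun p => ?_
  have := truncCode_le x p
  unfold monoCode
  nlinarith

lemma le_monoCode (x : ℕ → ℝ) (p : ℕ) : p ≤ monoCode x p := by
  unfold monoCode
  nlinarith [Nat.le_self_pow two_ne_zero p]

lemma measurable_monoCode (p : ℕ) : Measurable fun x => monoCode x p := by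
  have h : Measurable fun x : ℕ → ℝ => ⌊x p.unpair.1 + p.unpair.2⌋₊ :=
    Nat.measurable_floor.comp ((measurable_pi_apply _).add_const _)
  exact (h.min measurable_const).const_add _

lemma countBelow_le_countBelow_add {f h : ℕ → ℕ} {b : ℕ} (hfh : ∀ p, h p ≤ f p + b) (n : ℕ) :
    countBelow f n ≤ countBelow h (n + b) := by
  refine Finset.card_le_card fun p hp => ?_
  have := hfh p
  simp only [Finset.mem_filter, Finset.mem_range] at hp ⊢
  omega

lemma lt_countBelow {f : ℕ → ℕ} (hf : Monotone f) (hf' : ∀ p, p ≤ f p) (p : ℕ) :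
    p < countBelow f (f p) := by
  have h : Finset.range (p + 1) ⊆ (Finset.range (f p + 1)).filter fun q => f q ≤ f p := by
    intro q hq
    have hqp : q ≤ p := Nat.lt_succ_iff.mp (Finset.mem_range.mp hq)
    have := hf hqp
    have := hf' p
    simp only [Finset.mem_filter, Finset.mem_range]
    omega
  simpa [countBelow] using Finset.card_le_card h

lemma le_of_lt_countBelow {f : ℕ → ℕ} (hf : Monotone f) {p n : ℕ} (h : p < countBelow f n) :
    f p ≤ n := by
  by_contra! hn
  have hsub : ((Finset.range (n + 1)).filter fun q => f q ≤ n) ⊆ Finset.range p := by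
    intro q hq
    rw [Finset.mem_range]
    by_contra! hpq
    have := hf hpq
    have := (Finset.mem_filter.mp hq).2
    omega
  have := Finset.card_le_card hsub
  rw [Finset.card_range] at this
  exact absurd h (not_lt.mpr this)

lemma krel_countBelow_iff {f h : ℕ → ℕ} (hf : Monotone f) (hf' : ∀ p, p ≤ f p)
    (hh : Monotone h) (hh' : ∀ p, p ≤ h p) :
    Krel (countBelow f) (countBelow h) ↔ ∃ b, ∀ p, f p ≤ h p + b ∧ h p ≤ f p + b := by
  constructor
  · rintro ⟨b, hb⟩
    refine ⟨b, fun p => ⟨?_, ?_⟩⟩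
    · obtain ⟨m, hm, -, -, -, hle⟩ := hb (h p)
      have := le_of_lt_countBelow hf ((lt_countBelow hh hh' p).trans_le hle)
      omega
    · obtain ⟨-, -, m, hm, hle, -⟩ := hb (f p)
      have := le_of_lt_countBelow hh ((lt_countBelow hf hf' p).trans_le hle)
      omega
  · rintro ⟨b, hb⟩
    exact ⟨b, fun n => ⟨b, le_rfl, b, le_rfl,
      countBelow_le_countBelow_add (fun p => (hb p).2) n,
      countBelow_le_countBelow_add (fun p => (hb p).1) n⟩⟩

lemma natFloor_le_natFloor_add {a c : ℝ} {b : ℕ} (h : a ≤ c + b) : ⌊a⌋₊ ≤ ⌊c⌋₊ + b := by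
  refine Nat.lt_succ_iff.mp ((Nat.floor_lt' (Nat.succ_ne_zero _)).mpr ?_)
  have := Nat.lt_floor_add_one c
  push_cast
  linarith

lemma truncCode_le_add {x y : ℕ → ℝ} {b : ℕ} (h : ∀ k, x k ≤ y k + b) (p : ℕ) :
    truncCode x p ≤ truncCode y p + b := by
  have : ⌊x p.unpair.1 + p.unpair.2⌋₊ ≤ ⌊y p.unpair.1 + p.unpair.2⌋₊ + b :=
    natFloor_le_natFloor_add (by linarith [h p.unpair.1])
  unfold truncCode
  omega

lemma truncCode_pair {x : ℕ → ℝ} {k l : ℕ} (h : |x k| ≤ l) :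
    truncCode x (Nat.pair k l) = ⌊x k + l⌋₊ := by
  have : ⌊x k + l⌋₊ ≤ 2 * l := by
    refine Nat.floor_le_of_le ?_
    push_cast
    linarith [(abs_le.mp h).2]
  simpa [truncCode] using this

lemma le_add_of_truncCode_le {x y : ℕ → ℝ} {b : ℕ}
    (h : ∀ p, truncCode x p ≤ truncCode y p + b) (k : ℕ) : x k ≤ y k + (b + 1) := by
  obtain ⟨l, hl⟩ := exists_nat_ge (max |x k| |y k|)
  have hy : |y k| ≤ l := (le_max_right _ _).trans hl
  have hp := h (Nat.pair k l)
  rw [truncCode_pair ((le_max_left _ _).trans hl), truncCode_pair hy] at hp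
  have hp' : (⌊x k + l⌋₊ : ℝ) ≤ ⌊y k + l⌋₊ + b := by exact_mod_cast hp
  have h1 := Nat.lt_floor_add_one (x k + l)
  have h2 := Nat.floor_le (show 0 ≤ y k + l by linarith [(abs_le.mp hy).1])
  linarith

lemma elinf_iff_monoCode (x y : ℕ → ℝ) :
    Elinf x y ↔ ∃ b, ∀ p, monoCode x p ≤ monoCode y p + b ∧ monoCode y p ≤ monoCode x p + b := by
  simp only [monoCode, add_assoc, add_le_add_iff_left]
  constructor
  · rintro ⟨C, hC⟩
    have hb := fun k => abs_le.mp ((hC k).trans (Nat.le_ceil C))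
    exact ⟨⌈C⌉₊, fun p => ⟨truncCode_le_add (fun k => by linarith [(hb k).2]) p,
      truncCode_le_add (fun k => by linarith [(hb k).1]) p⟩⟩
  · rintro ⟨b, hb⟩
    refine ⟨b + 1, fun k => abs_le.mpr ⟨?_, ?_⟩⟩
    · linarith [le_add_of_truncCode_le (fun p => (hb p).2) k]
    · linarith [le_add_of_truncCode_le (fun p => (hb p).1) k]

/-- `E_{ℓ∞}` is Borel reducible to `K`. -/
theorem stmt7 :
    ∃ g : (ℕ → ℝ) → (ℕ → ℕ), Measurable g ∧
      ∀ x y : ℕ → ℝ, (Elinf x y ↔ Krel (g x) (g y)) := by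
  refine ⟨fun x => countBelow (monoCode x), measurable_pi_lambda _ fun n => ?_, fun x y => ?_⟩
  · simp only [countBelow, Finset.card_filter]
    exact Finset.measurable_fun_sum _ fun p _ => Measurable.ite
      (measurableSet_le (measurable_monoCode p) measurable_const) measurable_const measurable_const
  · rw [krel_countBelow_iff (monoCode_monotone x) (le_monoCode x) (monoCode_monotone y)
      (le_monoCode y)]
    exact elinf_iff_monoCode x y
end

section
/- K is Borel reducible to E_{ℓ∞}: there exists a Borel function f : ℕ^ℕ → ℝ^ℕ such that for all x, y ∈ ℕ^ℕ, x K y if and only if f(x) E_{ℓ∞} f(y). -/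
open Set Filter

lemma exists_hit (x : ℕ → ℕ) (n k j : ℕ) : ∃ m, j ≤ m ∨ k ≤ x (n + m) := ⟨j, .inl le_rfl⟩

/-- The least `m` with `k ≤ x (n + m)`, capped at `j`. -/
def hitTime (x : ℕ → ℕ) (n k j : ℕ) : ℕ := Nat.find (exists_hit x n k j)

lemma hitTime_spec (x : ℕ → ℕ) (n k j : ℕ) :
    j ≤ hitTime x n k j ∨ k ≤ x (n + hitTime x n k j) := Nat.find_spec (exists_hit x n k j)

lemma hitTime_le {x : ℕ → ℕ} {n k j m : ℕ} (h : j ≤ m ∨ k ≤ x (n + m)) :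
    hitTime x n k j ≤ m := Nat.find_min' (exists_hit x n k j) h

lemma measurable_hitTime (n k j : ℕ) : Measurable fun x : ℕ → ℕ => hitTime x n k j := by
  refine measurable_find (fun x => exists_hit x n k j) fun m => ?_
  exact (MeasurableSet.const _).union (measurableSet_le measurable_const (measurable_pi_apply _))

lemma hitTime_le_add {x y : ℕ → ℕ} {b : ℕ} (h : ∀ n, ∃ m ≤ b, x n ≤ y (n + m)) (n k j : ℕ) :
    hitTime y n k j ≤ hitTime x n k j + b := by
  rcases hitTime_spec x n k j with hj | hk
  · exact hitTime_le (.inl (by lia))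
  · obtain ⟨m, hm, hxy⟩ := h (n + hitTime x n k j)
    have : hitTime y n k j ≤ hitTime x n k j + m :=
      hitTime_le (.inr (by rw [← add_assoc]; exact hk.trans hxy))
    lia

lemma exists_le_of_hitTime_le_add {x y : ℕ → ℕ} {b : ℕ}
    (h : ∀ n k j, hitTime y n k j ≤ hitTime x n k j + b) (n : ℕ) :
    ∃ m ≤ b, x n ≤ y (n + m) := by
  have h0 : hitTime x n (x n) (b + 1) ≤ 0 := hitTime_le (.inr le_rfl)
  have hb := h n (x n) (b + 1)
  refine ⟨hitTime y n (x n) (b + 1), by lia, ?_⟩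
  exact (hitTime_spec y n (x n) (b + 1)).resolve_left (by lia)

lemma krel_iff_hitTime (x y : ℕ → ℕ) :
    Krel x y ↔ ∃ b, ∀ n k j, hitTime y n k j ≤ hitTime x n k j + b ∧
      hitTime x n k j ≤ hitTime y n k j + b := by
  constructor
  · rintro ⟨b, h⟩
    refine ⟨b, fun n k j => ⟨hitTime_le_add (fun i => ?_) n k j,
      hitTime_le_add (fun i => ?_) n k j⟩⟩
    · obtain ⟨_, _, my, hmy, hx, _⟩ := h i
      exact ⟨my, hmy, hx⟩
    · obtain ⟨mx, hmx, _, _, _, hy⟩ := h i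
      exact ⟨mx, hmx, hy⟩
  · rintro ⟨b, h⟩
    refine ⟨b, fun n => ?_⟩
    obtain ⟨my, hmy, hx⟩ := exists_le_of_hitTime_le_add (fun n k j => (h n k j).1) n
    obtain ⟨mx, hmx, hy⟩ := exists_le_of_hitTime_le_add (fun n k j => (h n k j).2) n
    exact ⟨mx, hmx, my, hmy, hx, hy⟩

/-- `K` is Borel reducible to `E_{ℓ∞}`. -/
theorem stmt8 :
    ∃ f : (ℕ → ℕ) → (ℕ → ℝ), Measurable f ∧
      ∀ x y : ℕ → ℕ, (Krel x y ↔ Elinf (f x) (f y)) := by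
  refine ⟨fun x i => hitTime x i.unpair.1 i.unpair.2.unpair.1 i.unpair.2.unpair.2,
    measurable_pi_lambda _ fun i => measurable_from_top.comp (measurable_hitTime _ _ _),
    fun x y => ?_⟩
  rw [krel_iff_hitTime]
  constructor
  · rintro ⟨b, h⟩
    refine ⟨b, fun i => ?_⟩
    obtain ⟨h₁, h₂⟩ := h i.unpair.1 i.unpair.2.unpair.1 i.unpair.2.unpair.2
    beta_reduce
    rw [abs_sub_le_iff, sub_le_iff_le_add', sub_le_iff_le_add']
    exact ⟨mod_cast h₂, mod_cast h₁⟩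
  · rintro ⟨C, h⟩
    obtain ⟨b, hb⟩ := exists_nat_ge C
    refine ⟨b, fun n k j => ?_⟩
    have hC := (h (Nat.pair n (Nat.pair k j))).trans hb
    simp only [Nat.unpair_pair] at hC
    rw [abs_sub_le_iff, sub_le_iff_le_add', sub_le_iff_le_add'] at hC
    exact ⟨mod_cast hC.2, mod_cast hC.1⟩
end

section
/- Let T be a Laver tree and let p be a function from T to finite binary sequences that is monotone (s ⊆ t implies p(s) ⊆ p(t)) and length-preserving (the length of p(t) equals the length of t). Then for every node t ∈ T extending (or equal to) the stem of T and every n ∈ ℕ, there is a direct extension T' ≤₀ T_t, where T_t = {u ∈ T : u is comparable with t}, such that for all branches x, y ∈ [T'] and all m ≤ n, p(x restricted to m) = p(y restricted to m). -/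
open Set Filter

theorem Set.Infinite.exists_infinite_fiber_of_mapsTo {α β : Type*} {s : Set α} {F : Set β}
    (hs : s.Infinite) (hF : F.Finite) {f : α → β} (hf : MapsTo f s F) :
    ∃ b, {a | a ∈ s ∧ f a = b}.Infinite := by
  by_contra! h
  refine hs ((hF.biUnion fun b _ => h b).subset fun a ha => ?_)
  exact mem_biUnion (hf ha) ⟨ha, rfl⟩

theorem isStemOf_comparable {T : Set (List ℕ)} {s t : List ℕ} (hs : IsStemOf T s) (ht : t ∈ T)
    (hst : s <+: t) : IsStemOf {u | u ∈ T ∧ (u <+: t ∨ t <+: u)} t := by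
  refine ⟨⟨ht, Or.inl List.prefix_rfl⟩, fun u hu => hu.2, fun u hu htu => ?_⟩
  refine (hs.2.2 u hu.1 (hst.trans htu)).mono fun i hi => ?_
  exact ⟨hi, Or.inr (htu.trans (List.prefix_append _ _))⟩

/-- A union of trees with stems `t ++ [i]`, over infinitely many `i`, has stem `t`. -/
theorem isStemOf_biUnion {t : List ℕ} {A : Set ℕ} (hA : A.Infinite) {S : ℕ → Set (List ℕ)}
    (hclosed : ∀ i ∈ A, ∀ u ∈ S i, ∀ v : List ℕ, v <+: u → v ∈ S i)
    (hstem : ∀ i ∈ A, IsStemOf (S i) (t ++ [i])) : IsStemOf (⋃ i ∈ A, S i) t := by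
  refine ⟨?_, fun u hu => ?_, fun u hu htu => ?_⟩
  · obtain ⟨i, hi⟩ := hA.nonempty
    exact mem_biUnion hi (hclosed i hi _ (hstem i hi).1 _ (List.prefix_append _ _))
  · obtain ⟨i, hi, hu⟩ := mem_iUnion₂.1 hu
    rcases (hstem i hi).2.1 u hu with h | h
    · exact List.prefix_or_prefix_of_prefix h (List.prefix_append _ _)
    · exact Or.inr ((List.prefix_append _ _).trans h)
  · obtain ⟨i, hi, hu⟩ := mem_iUnion₂.1 hu
    have of_prefix (h : t ++ [i] <+: u) : {n : ℕ | u ++ [n] ∈ ⋃ i ∈ A, S i}.Infinite :=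
      ((hstem i hi).2.2 u hu h).mono fun n hn => mem_biUnion hi hn
    rcases (hstem i hi).2.1 u hu with h | h
    · rcases List.prefix_concat_iff.1 h with h | h
      · exact of_prefix (h ▸ List.prefix_rfl)
      · obtain rfl : u = t := h.eq_of_length_le htu.length_le
        exact hA.mono fun n hn => mem_biUnion hn (hstem n hn).1
    · exact of_prefix h

/-- Above any node `t` extending the stem there is a subtree with stem `t` on whose level
`t.length + k` the function `p` is constant. -/
theorem exists_subtree_eq_on_level {T : Set (List ℕ)} {s : List ℕ} (hs : IsStemOf T s)
    (hclosed : ∀ u ∈ T, ∀ v : List ℕ, v <+: u → v ∈ T) {p : List ℕ → List Bool}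
    (hlen : ∀ t ∈ T, (p t).length = t.length) (k : ℕ) :
    ∀ t ∈ T, s <+: t → ∃ (S : Set (List ℕ)) (w : List Bool), S ⊆ T ∧
      (∀ u ∈ S, ∀ v : List ℕ, v <+: u → v ∈ S) ∧ IsStemOf S t ∧ w.length = t.length + k ∧
      ∀ u ∈ S, u.length = t.length + k → p u = w := by
  induction k with
  | zero =>
    intro t ht hst
    refine ⟨{u | u ∈ T ∧ (u <+: t ∨ t <+: u)}, p t, fun u hu => hu.1, ?_,
      isStemOf_comparable hs ht hst, hlen t ht, fun u hu hl => ?_⟩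
    · rintro u ⟨hu, h | h⟩ v hv
      · exact ⟨hclosed u hu v hv, Or.inl (hv.trans h)⟩
      · exact ⟨hclosed u hu v hv, List.prefix_or_prefix_of_prefix hv h⟩
    · rcases hu.2 with h | h
      · rw [h.eq_of_length hl]
      · rw [h.eq_of_length hl.symm]
  | succ k ih =>
    intro t ht hst
    have step (i : ℕ) (hi : t ++ [i] ∈ T) := ih (t ++ [i]) hi (hst.trans (List.prefix_append _ _))
    choose! S w hST hS hstem hw hp using step
    obtain ⟨w₀, hA⟩ := (hs.2.2 t ht hst).exists_infinite_fiber_of_mapsTo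
      (List.finite_length_eq Bool (t.length + (k + 1))) (f := w) fun i hi => by
        have := hw i hi
        simp only [List.length_append, List.length_singleton] at this
        simp only [Set.mem_ofPred_eq]
        omega
    refine ⟨⋃ i ∈ {i | i ∈ {n | t ++ [n] ∈ T} ∧ w i = w₀}, S i, w₀,
      iUnion₂_subset fun i hi => hST i hi.1, fun u hu v hv => ?_,
      isStemOf_biUnion hA (fun i hi => hS i hi.1) fun i hi => hstem i hi.1, ?_, fun u hu hl => ?_⟩
    · obtain ⟨i, hi, hu⟩ := mem_iUnion₂.1 hu
      exact mem_biUnion hi (hS i hi.1 u hu v hv)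
    · obtain ⟨i, hi, rfl⟩ := hA.nonempty
      have := hw i hi
      simp only [List.length_append, List.length_singleton] at this
      omega
    · obtain ⟨i, hi, hu⟩ := mem_iUnion₂.1 hu
      rw [← hi.2]
      refine hp i hi.1 u hu ?_
      simp only [List.length_append, List.length_singleton]
      omega

/-- homogenization up to level `n` above any node `t` extending
the stem (Observation in the paper). -/
theorem stmt11 (T : Set (List ℕ)) (hT : IsLaverTree T)
    (p : List ℕ → List Bool)
    (hmono : ∀ s ∈ T, ∀ t ∈ T, s <+: t → p s <+: p t)
    (hlen : ∀ t ∈ T, (p t).length = t.length)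
    (s : List ℕ) (hs : IsStemOf T s)
    (t : List ℕ) (ht : t ∈ T) (hst : s <+: t) (n : ℕ) :
    ∃ T', DirectExt T' {u | u ∈ T ∧ (u <+: t ∨ t <+: u)} ∧
      ∀ x ∈ branches T', ∀ y ∈ branches T', ∀ m ≤ n, p (seg x m) = p (seg y m) := by
  obtain ⟨S, w, hST, hS, hstem, -, hp⟩ := exists_subtree_eq_on_level hs hT.1 hlen n t ht hst
  refine ⟨S, ⟨⟨hS, t, hstem⟩, fun u hu => ⟨hST hu, hstem.2.1 u hu⟩, t, hstem,
    isStemOf_comparable hs ht hst⟩, fun x hx y hy m hm => ?_⟩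
  have key (z : ℕ → ℕ) (hz : z ∈ branches S) : p (seg z m) = w.take m := by
    have h := hmono _ (hST (hz m)) _ (hST (hz (t.length + n))) (seg_prefix_seg z (by omega))
    rw [hp _ (hz _) (length_seg _ _), List.prefix_iff_eq_take, hlen _ (hST (hz m)),
      length_seg] at h
    exact h
  rw [key x hx, key y hy]
end

section
/- Let μ be a lower semicontinuous submeasure on ℕ, let V be a Laver tree, and let f : [V] → 2^ℕ be a function such that for all distinct branches x, y ∈ [V], if n is the length of the longest common initial segment of x and y, then μ({m ≥ n : f(x)(m) ≠ f(y)(m)}) > 1. Then for every x ∈ [V], the set {y ∈ [V] : {m : f(x)(m) ≠ f(y)(m)} ∈ Exh(μ)} is countable. -/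
open Set Filter

/-- if branches splitting at level `n` are mapped by `f` at
`μ`-distance `> 1` past `n`, then `Exh(μ)`-classes (pulled back by `f`) are
countable on the branches. -/
theorem stmt12 (μ : Set ℕ → ENNReal) (hμ : IsLSCSubmeasure μ)
    (V : Set (List ℕ)) (hV : IsLaverTree V)
    (f : (ℕ → ℕ) → (ℕ → Bool))
    (hsep : ∀ x ∈ branches V, ∀ y ∈ branches V, ∀ n : ℕ,
      (∀ i < n, x i = y i) → x n ≠ y n →
        1 < μ {m | n ≤ m ∧ f x m ≠ f y m}) :
    ∀ x ∈ branches V,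
      {y | y ∈ branches V ∧ {m | f x m ≠ f y m} ∈ Exh μ}.Countable := by
  obtain ⟨-, hmono, hunion, -⟩ := hμ
  intro x _
  have htail : ∀ y, {m | f x m ≠ f y m} ∈ Exh μ →
      ∃ N : ℕ, μ ({m | f x m ≠ f y m} \ Set.Iio N) < 2⁻¹ := by
    intro y hy
    have hlim : Tendsto (fun n : ℕ => μ ({m | f x m ≠ f y m} \ Set.Iio n)) atTop (nhds 0) := hy
    exact (hlim.eventually (gt_mem_nhds (ENNReal.inv_pos.2 ENNReal.ofNat_ne_top))).exists
  choose! N hN using htail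
  have hinj : Set.InjOn (fun y => (N y, seg y (N y)))
      {y | y ∈ branches V ∧ {m | f x m ≠ f y m} ∈ Exh μ} := by
    rintro y ⟨hyV, hy⟩ z ⟨hzV, hz⟩ hyz
    obtain ⟨hNyz, hseg⟩ := Prod.mk.inj hyz
    rw [← hNyz] at hseg
    have hagree : ∀ i < N y, y i = z i := fun i hi =>
      congrFun (List.ofFn_injective hseg) ⟨i, hi⟩
    by_contra hne
    have hex : ∃ n, y n ≠ z n := Function.ne_iff.1 hne
    classical
    have hle : N y ≤ Nat.find hex := by
      by_contra! hlt
      exact Nat.find_spec hex (hagree _ hlt)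
    have hgt := hsep y hyV z hzV (Nat.find hex)
      (fun i hi => not_not.1 (Nat.find_min hex hi)) (Nat.find_spec hex)
    refine hgt.not_ge ?_
    calc μ {m | Nat.find hex ≤ m ∧ f y m ≠ f z m}
        ≤ μ (({m | f x m ≠ f y m} \ Set.Iio (N y)) ∪ ({m | f x m ≠ f z m} \ Set.Iio (N z))) := by
          refine hmono _ _ ?_
          rintro m ⟨hm, hfm⟩
          have hmN : N y ≤ m := hle.trans hm
          by_cases hxy : f x m = f y m
          · exact Or.inr ⟨fun hxz => hfm (hxy.symm.trans hxz), (hNyz ▸ hmN).not_gt⟩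
          · exact Or.inl ⟨hxy, hmN.not_gt⟩
      _ ≤ 2⁻¹ + 2⁻¹ := (hunion _ _).trans (add_le_add (hN y hy).le (hN z hz).le)
      _ = 1 := ENNReal.inv_two_add_inv_two
  exact Set.MapsTo.countable_of_injOn (Set.mapsTo_univ _ _) hinj (Set.to_countable _)
end
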